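/- Let k ≥ 1 be an integer, ξ > 1 a real number, and w a (k,ξ)-admissible function. Let F(s) = Σ_{n ≥ 1} a_n n^{−s} be a Dirichlet series that converges absolutely for Re(s) > κ_a, and let x ≥ 1, T ≥ 1, and κ > κ_a > 0. Then |Σ_{n ≤ x} a_n − (1/(2πi)) ∫_T^{ξT} (∫_{κ−it}^{κ+it} F(s) x^s/s ds) (w(t/T)/T) dt| ≤ (k+1) · (2 N_{k,ξ}(w)/T^{k+1}) · ∫_{θ'/T}^{∞} (Σ_{n : |log(x/n)| ≤ u} |a_n|/n^{κ}) x^{κ} u^{−(k+2)} du, where θ' = θ'_{k,ξ}(w). -/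

import Mathlib

open MeasureTheory

/-- A function `w` defined over `[1, ξ]` is `(k, ξ)`-admissible if it is `k`-times
differentiable with `w^(k) ∈ L¹`, integrates to `1` over `[1, ξ]`, and satisfies
`w^(ℓ)(1) = w^(ℓ)(ξ) = 0` for `0 ≤ ℓ ≤ k - 2`. -/
structure IsAdmissible (k : ℕ) (ξ : ℝ) (w : ℝ → ℝ) : Prop where
  diff : ∀ i < k, DifferentiableOn ℝ (iteratedDeriv i w) (Set.Icc 1 ξ)
  integ : IntegrableOn (iteratedDeriv k w) (Set.Icc 1 ξ)
  normal : (∫ t in (1:ℝ)..ξ, w t) = 1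
  boundary : ∀ ℓ : ℕ, ℓ + 2 ≤ k → iteratedDeriv ℓ w 1 = 0 ∧ iteratedDeriv ℓ w ξ = 0

/-- The quantity `N_{k,ξ}(w)` defined by
`2π N_{k,ξ}(w) = |w^(k-1)(ξ)|/ξ + |w^(k-1)(1)| + k! ∑_{0 ≤ h ≤ k} (1/h!) ∫_1^ξ |w^(h)(u)|/u du`. -/
noncomputable def Nkxi (k : ℕ) (ξ : ℝ) (w : ℝ → ℝ) : ℝ :=
  (1 / (2 * Real.pi)) * (|iteratedDeriv (k - 1) w ξ| / ξ + |iteratedDeriv (k - 1) w 1| +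
    (k.factorial : ℝ) *
      ∑ h ∈ Finset.range (k + 1),
        (1 / (h.factorial : ℝ)) * ∫ u in (1:ℝ)..ξ, |iteratedDeriv h w u| / u)

/-- The quantity `L_ξ(w) = (1/π) ∫_1^ξ u |w(u)| du`. -/
noncomputable def Lxi (ξ : ℝ) (w : ℝ → ℝ) : ℝ :=
  (1 / Real.pi) * ∫ u in (1:ℝ)..ξ, u * |w u|

theorem Real.sin_le_taylor_five {t : ℝ} (ht : 0 ≤ t) :
    Real.sin t ≤ t - t ^ 3 / 6 + t ^ 5 / 120 := by
  have cos_le : ∀ x : ℝ, 0 ≤ x → Real.cos x ≤ 1 - x ^ 2 / 2 + x ^ 4 / 24 := by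
    intro x hx
    have hder : ∀ y : ℝ, HasDerivAt (fun y : ℝ => 1 - y ^ 2 / 2 + y ^ 4 / 24 - Real.cos y)
        (Real.sin y - (y - y ^ 3 / 6)) y := by
      intro y
      have h := (((hasDerivAt_const y (1 : ℝ)).sub ((hasDerivAt_pow 2 y).div_const 2)).add
        ((hasDerivAt_pow 4 y).div_const 24)).sub (Real.hasDerivAt_cos y)
      convert! h using 1
      norm_num
      ring
    have hmono : MonotoneOn (fun y : ℝ => 1 - y ^ 2 / 2 + y ^ 4 / 24 - Real.cos y)
        (Set.Ici 0) := by
      refine monotoneOn_of_deriv_nonneg (convex_Ici 0)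
        (fun y _ => (hder y).continuousAt.continuousWithinAt)
        (fun y _ => (hder y).differentiableAt.differentiableWithinAt) fun y hy => ?_
      rw [interior_Ici] at hy
      rw [(hder y).deriv]
      linarith [Real.sin_ge_sub_cube (le_of_lt hy)]
    have := hmono (Set.mem_Ici.2 le_rfl) (Set.mem_Ici.2 hx) hx
    norm_num at this
    linarith
  have hder : ∀ y : ℝ, HasDerivAt (fun y : ℝ => y - y ^ 3 / 6 + y ^ 5 / 120 - Real.sin y)
      (1 - y ^ 2 / 2 + y ^ 4 / 24 - Real.cos y) y := by
    intro y
    have h := (((hasDerivAt_id y).sub ((hasDerivAt_pow 3 y).div_const 6)).add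
      ((hasDerivAt_pow 5 y).div_const 120)).sub (Real.hasDerivAt_sin y)
    convert! h using 1
    norm_num
    ring
  have hmono : MonotoneOn (fun y : ℝ => y - y ^ 3 / 6 + y ^ 5 / 120 - Real.sin y)
      (Set.Ici 0) := by
    refine monotoneOn_of_deriv_nonneg (convex_Ici 0)
      (fun y _ => (hder y).continuousAt.continuousWithinAt)
      (fun y _ => (hder y).differentiableAt.differentiableWithinAt) fun y hy => ?_
    rw [interior_Ici] at hy
    rw [(hder y).deriv]
    linarith [cos_le y (le_of_lt hy)]
  have := hmono (Set.mem_Ici.2 le_rfl) (Set.mem_Ici.2 ht) ht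
  norm_num at this
  linarith

theorem Real.three_mul_div_le_arctan {x : ℝ} (hx : 0 ≤ x) :
    3 * x / (3 + x ^ 2) ≤ Real.arctan x := by
  have hder : ∀ y : ℝ, HasDerivAt (fun y : ℝ => Real.arctan y - 3 * y / (3 + y ^ 2))
      (1 / (1 + y ^ 2) - (3 * (3 + y ^ 2) - 3 * y * (2 * y)) / (3 + y ^ 2) ^ 2) y := by
    intro y
    have h := (Real.hasDerivAt_arctan y).sub
      (((hasDerivAt_id y).const_mul 3).div ((hasDerivAt_pow 2 y).const_add 3)
        (by positivity : (3 : ℝ) + y ^ 2 ≠ 0))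
    convert! h using 1
    norm_num
  have hmono : MonotoneOn (fun y : ℝ => Real.arctan y - 3 * y / (3 + y ^ 2)) (Set.Ici 0) := by
    refine monotoneOn_of_deriv_nonneg (convex_Ici 0)
      (fun y _ => (hder y).continuousAt.continuousWithinAt)
      (fun y _ => (hder y).differentiableAt.differentiableWithinAt) fun y hy => ?_
    rw [(hder y).deriv]
    have : 1 / (1 + y ^ 2) - (3 * (3 + y ^ 2) - 3 * y * (2 * y)) / (3 + y ^ 2) ^ 2 =
        4 * y ^ 4 / ((1 + y ^ 2) * (3 + y ^ 2) ^ 2) := by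
      field_simp
      ring
    rw [this]
    positivity
  have := hmono (Set.mem_Ici.2 le_rfl) (Set.mem_Ici.2 hx) hx
  norm_num at this
  linarith

/-- The real truncated Perron kernel, normalised so that it tends to `π e^{-bκ}` (if `0 < b`)
or `0` (if `b < 0`) as `u → ∞`. -/
noncomputable def perronReal (b κ u : ℝ) : ℝ :=
  ∫ τ in (0 : ℝ)..u, (κ * Real.cos (b * τ) + τ * Real.sin (b * τ)) / (κ ^ 2 + τ ^ 2)

theorem continuous_perronReal_integrand (b : ℝ) {κ : ℝ} (hκ : 0 < κ) :
    Continuous fun τ : ℝ =>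
      (κ * Real.cos (b * τ) + τ * Real.sin (b * τ)) / (κ ^ 2 + τ ^ 2) :=
  Continuous.div (by fun_prop) (by fun_prop) fun τ => by positivity

theorem integral_zero_div_sq_add_sq (κ u : ℝ) :
    ∫ τ in (0 : ℝ)..u, κ / (κ ^ 2 + τ ^ 2) = Real.arctan (u / κ) := by
  rw [integral_div_sq_add_sq]
  simp

theorem continuous_div_sq_add_sq {κ : ℝ} (hκ : 0 < κ) :
    Continuous fun τ : ℝ => κ / (κ ^ 2 + τ ^ 2) :=
  Continuous.div (by fun_prop) (by fun_prop) fun τ => by positivity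

theorem abs_perronReal_le_div (b : ℝ) {κ u : ℝ} (hκ : 0 < κ) (hu : 0 ≤ u) :
    |perronReal b κ u| ≤ u / κ := by
  have h := intervalIntegral.norm_integral_le_of_norm_le_const (a := 0) (b := u) (C := 1 / κ)
    (f := fun τ : ℝ => (κ * Real.cos (b * τ) + τ * Real.sin (b * τ)) / (κ ^ 2 + τ ^ 2)) ?_
  · rw [Real.norm_eq_abs, sub_zero, abs_of_nonneg hu] at h
    exact h.trans_eq (by ring)
  · intro τ _
    have hpos : 0 < κ ^ 2 + τ ^ 2 := by positivity
    rw [Real.norm_eq_abs, abs_div, abs_of_pos hpos, div_le_div_iff₀ hpos hκ, one_mul]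
    have hs := Real.sin_sq_add_cos_sq (b * τ)
    have h1 : (κ * Real.cos (b * τ) + τ * Real.sin (b * τ)) ^ 2 ≤ κ ^ 2 + τ ^ 2 := by
      have : (κ * Real.cos (b * τ) + τ * Real.sin (b * τ)) ^ 2 +
          (κ * Real.sin (b * τ) - τ * Real.cos (b * τ)) ^ 2 = κ ^ 2 + τ ^ 2 := by
        linear_combination (κ ^ 2 + τ ^ 2) * hs
      nlinarith [sq_nonneg (κ * Real.sin (b * τ) - τ * Real.cos (b * τ))]
    rw [← abs_of_pos hκ, ← abs_mul]
    rw [abs_of_pos hκ]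
    refine abs_le_of_sq_le_sq ?_ hpos.le
    rw [mul_pow]
    nlinarith [mul_le_mul_of_nonneg_right h1 (sq_nonneg κ), sq_nonneg τ]

theorem abs_perronReal_sub_arctan_le (b : ℝ) {κ u : ℝ} (hκ : 0 < κ) (hu : 0 ≤ u) :
    |perronReal b κ u - Real.arctan (u / κ)| ≤ |b| * u := by
  rw [perronReal, ← integral_zero_div_sq_add_sq, ← intervalIntegral.integral_sub
    ((continuous_perronReal_integrand b hκ).intervalIntegrable _ _)
    ((continuous_div_sq_add_sq hκ).intervalIntegrable _ _)]
  have h := intervalIntegral.norm_integral_le_of_norm_le_const (a := 0) (b := u) (C := |b|)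
    (f := fun τ : ℝ => (κ * Real.cos (b * τ) + τ * Real.sin (b * τ)) / (κ ^ 2 + τ ^ 2) -
      κ / (κ ^ 2 + τ ^ 2)) ?_
  · rwa [Real.norm_eq_abs, sub_zero, abs_of_nonneg hu] at h
  · intro τ _
    have hpos : 0 < κ ^ 2 + τ ^ 2 := by positivity
    rw [← sub_div, Real.norm_eq_abs, abs_div, abs_of_pos hpos, div_le_iff₀ hpos]
    refine abs_le_of_sq_le_sq ?_ (by positivity)
    have hs := Real.sin_sq_add_cos_sq (b * τ)
    have hc := Real.one_sub_sq_div_two_le_cos (x := b * τ)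
    have h1 : (κ * Real.cos (b * τ) + τ * Real.sin (b * τ) - κ) ^ 2 +
        (κ * Real.sin (b * τ) - τ * (Real.cos (b * τ) - 1)) ^ 2 =
        (κ ^ 2 + τ ^ 2) * (2 - 2 * Real.cos (b * τ)) := by
      linear_combination (κ ^ 2 + τ ^ 2) * hs
    calc (κ * Real.cos (b * τ) + τ * Real.sin (b * τ) - κ) ^ 2
        ≤ (κ ^ 2 + τ ^ 2) * (2 - 2 * Real.cos (b * τ)) := by
          nlinarith [sq_nonneg (κ * Real.sin (b * τ) - τ * (Real.cos (b * τ) - 1))]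
      _ ≤ (κ ^ 2 + τ ^ 2) * (b ^ 2 * (κ ^ 2 + τ ^ 2)) := by
          refine mul_le_mul_of_nonneg_left ?_ hpos.le
          nlinarith [mul_nonneg (sq_nonneg b) (sq_nonneg κ)]
      _ = (|b| * (κ ^ 2 + τ ^ 2)) ^ 2 := by rw [mul_pow, sq_abs]; ring

theorem perronReal_le_arctan {b κ u : ℝ} (hκ : 0 < κ) (hu : 0 ≤ u) (hb : b ≤ 0)
    (hbu : -b * u ≤ 3) : perronReal b κ u ≤ Real.arctan (u / κ) := by
  rw [perronReal, ← integral_zero_div_sq_add_sq]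
  refine intervalIntegral.integral_mono_on hu
    ((continuous_perronReal_integrand b hκ).intervalIntegrable _ _)
    ((continuous_div_sq_add_sq hκ).intervalIntegrable _ _) fun τ hτ => ?_
  refine div_le_div_of_nonneg_right ?_ (by positivity)
  have hs : 0 ≤ Real.sin (-b * τ) := by
    refine Real.sin_nonneg_of_nonneg_of_le_pi (mul_nonneg (by linarith) hτ.1) ?_
    have : -b * τ ≤ -b * u := mul_le_mul_of_nonneg_left hτ.2 (by linarith)
    linarith [Real.pi_gt_three]
  rw [neg_mul, Real.sin_neg] at hs
  nlinarith [Real.cos_le_one (b * τ), hτ.1]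

theorem Real.one_le_cos_add_mul_sin {t : ℝ} (h0 : 0 ≤ t) (h2 : t ≤ 2) :
    1 ≤ Real.cos t + t * Real.sin t := by
  obtain ⟨r, rfl⟩ : ∃ r, t = 2 * r := ⟨t / 2, by ring⟩
  have hr0 : 0 ≤ r := by linarith
  have hsin0 : 0 ≤ Real.sin r :=
    Real.sin_nonneg_of_nonneg_of_le_pi hr0 (by linarith [Real.pi_gt_three])
  have hsin := Real.sin_le hr0
  have hcos := Real.one_sub_sq_div_two_le_cos (x := r)
  have hcos' : 1 / 2 ≤ Real.cos r := by nlinarith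
  rw [Real.cos_two_mul, Real.sin_two_mul]
  have hs := Real.sin_sq_add_cos_sq r
  have : Real.sin r ≤ 2 * r * Real.cos r := by nlinarith
  nlinarith [mul_le_mul_of_nonneg_left this hsin0]

theorem arctan_le_perronReal {b κ u : ℝ} (hκ : 0 < κ) (hu : 0 ≤ u) (hb : 0 ≤ b)
    (hκb : κ * b ≤ 1) (hbu : b * u ≤ 2) : Real.arctan (u / κ) ≤ perronReal b κ u := by
  rw [perronReal, ← integral_zero_div_sq_add_sq]
  refine intervalIntegral.integral_mono_on hu
    ((continuous_div_sq_add_sq hκ).intervalIntegrable _ _)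
    ((continuous_perronReal_integrand b hκ).intervalIntegrable _ _) fun τ hτ => ?_
  refine div_le_div_of_nonneg_right ?_ (by positivity)
  have ht0 : 0 ≤ b * τ := mul_nonneg hb hτ.1
  have ht2 : b * τ ≤ 2 := (mul_le_mul_of_nonneg_left hτ.2 hb).trans hbu
  have hs : 0 ≤ Real.sin (b * τ) :=
    Real.sin_nonneg_of_nonneg_of_le_pi ht0 (by linarith [Real.pi_gt_three])
  have h1 := Real.one_le_cos_add_mul_sin ht0 ht2
  have h2 : κ * (b * τ) ≤ τ := by nlinarith [hτ.1]
  nlinarith [mul_le_mul_of_nonneg_left h1 hκ.le, mul_le_mul_of_nonneg_right h2 hs]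

theorem abs_perronReal_sub_le {b κ a u : ℝ} (hκ : 0 < κ) (ha : 0 < a) (hau : a ≤ u)
    (hb : b ≠ 0) : |perronReal b κ u - perronReal b κ a| ≤ 2 / (a * |b|) := by
  set r : ℝ → ℝ := fun τ =>
    (κ * Real.cos (b * τ) + τ * Real.sin (b * τ)) / (κ ^ 2 + τ ^ 2) with hr
  set E : ℝ → ℝ := fun τ =>
    (κ * Real.sin (b * τ) - τ * Real.cos (b * τ)) / (κ ^ 2 + τ ^ 2) with hE
  set S : ℝ → ℝ := fun τ =>
    ((κ ^ 2 - τ ^ 2) * Real.cos (b * τ) + 2 * κ * τ * Real.sin (b * τ)) /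
      (κ ^ 2 + τ ^ 2) ^ 2 with hS
  have hrc : Continuous r := continuous_perronReal_integrand b hκ
  have hSc : Continuous S :=
    Continuous.div (by fun_prop) (by fun_prop) fun τ => by positivity
  have hder : ∀ τ, HasDerivAt E (b * r τ - S τ) τ := by
    intro τ
    have hpos : κ ^ 2 + τ ^ 2 ≠ 0 := by positivity
    have hlin : HasDerivAt (fun τ : ℝ => b * τ) b τ := by
      simpa using (hasDerivAt_id τ).const_mul b
    have h := (((hlin.sin).const_mul κ).sub ((hasDerivAt_id τ).mul hlin.cos)).div
      ((hasDerivAt_pow 2 τ).const_add (κ ^ 2)) hpos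
    convert! h using 1
    simp only [hr, hS, id]
    field_simp
    norm_num
    ring
  have hFTC : ∫ τ in a..u, (b * r τ - S τ) = E u - E a :=
    intervalIntegral.integral_eq_sub_of_hasDerivAt (fun τ _ => hder τ)
      (((continuous_const.mul hrc).sub hSc).intervalIntegrable _ _)
  have hEb : ∀ τ, 0 < τ → |E τ| ≤ 1 / τ := by
    intro τ hτ
    have hpos : 0 < κ ^ 2 + τ ^ 2 := by positivity
    rw [hE]
    simp only
    rw [abs_div, abs_of_pos hpos, div_le_div_iff₀ hpos hτ, one_mul, ← abs_of_pos hτ, ← abs_mul,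
      abs_of_pos hτ]
    refine abs_le_of_sq_le_sq ?_ hpos.le
    have hs := Real.sin_sq_add_cos_sq (b * τ)
    have h1 : (κ * Real.sin (b * τ) - τ * Real.cos (b * τ)) ^ 2 +
        (κ * Real.cos (b * τ) + τ * Real.sin (b * τ)) ^ 2 = κ ^ 2 + τ ^ 2 := by
      linear_combination (κ ^ 2 + τ ^ 2) * hs
    have h2 : (κ * Real.sin (b * τ) - τ * Real.cos (b * τ)) ^ 2 ≤ κ ^ 2 + τ ^ 2 := by
      nlinarith [sq_nonneg (κ * Real.cos (b * τ) + τ * Real.sin (b * τ))]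
    rw [mul_pow]
    nlinarith [mul_le_mul_of_nonneg_right h2 (sq_nonneg τ), sq_nonneg κ]
  have hSb : ∀ τ, 0 < τ → |S τ| ≤ (τ ^ 2)⁻¹ := by
    intro τ hτ
    have hpos : 0 < κ ^ 2 + τ ^ 2 := by positivity
    have h2 : |(κ ^ 2 - τ ^ 2) * Real.cos (b * τ) + 2 * κ * τ * Real.sin (b * τ)| ≤
        κ ^ 2 + τ ^ 2 := by
      refine abs_le_of_sq_le_sq ?_ hpos.le
      have hs := Real.sin_sq_add_cos_sq (b * τ)
      have h1 : ((κ ^ 2 - τ ^ 2) * Real.cos (b * τ) + 2 * κ * τ * Real.sin (b * τ)) ^ 2 +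
          ((κ ^ 2 - τ ^ 2) * Real.sin (b * τ) - 2 * κ * τ * Real.cos (b * τ)) ^ 2 =
          (κ ^ 2 + τ ^ 2) ^ 2 := by
        linear_combination (κ ^ 2 + τ ^ 2) ^ 2 * hs
      nlinarith [sq_nonneg ((κ ^ 2 - τ ^ 2) * Real.sin (b * τ) - 2 * κ * τ * Real.cos (b * τ))]
    rw [hS]
    simp only
    rw [abs_div, abs_of_pos (by positivity : 0 < (κ ^ 2 + τ ^ 2) ^ 2)]
    calc _ ≤ (κ ^ 2 + τ ^ 2) / (κ ^ 2 + τ ^ 2) ^ 2 :=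
          div_le_div_of_nonneg_right h2 (by positivity)
      _ = (κ ^ 2 + τ ^ 2)⁻¹ := by field_simp
      _ ≤ (τ ^ 2)⁻¹ := inv_anti₀ (by positivity) (by nlinarith [sq_nonneg κ])
  have hinv : ∫ τ in a..u, (τ ^ 2)⁻¹ = 1 / a - 1 / u := by
    have hne : ∀ τ ∈ Set.uIcc a u, τ ≠ 0 := by
      intro τ hτ
      rw [Set.uIcc_of_le hau] at hτ
      exact (ha.trans_le hτ.1).ne'
    rw [intervalIntegral.integral_eq_sub_of_hasDerivAt (f := fun τ : ℝ => -τ⁻¹)]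
    · ring
    · intro τ hτ
      convert! (hasDerivAt_inv (hne τ hτ)).neg using 1
      simp
    · exact (ContinuousOn.inv₀ (by fun_prop) fun τ hτ =>
        pow_ne_zero 2 (hne τ hτ)).intervalIntegrable
  have hSint : |∫ τ in a..u, S τ| ≤ 1 / a - 1 / u := by
    rw [← hinv, ← Real.norm_eq_abs]
    refine intervalIntegral.norm_integral_le_of_norm_le hau (Filter.Eventually.of_forall
      fun τ hτ => (Real.norm_eq_abs _).le.trans (hSb τ (ha.trans hτ.1))) ?_
    refine (ContinuousOn.inv₀ (by fun_prop) fun τ hτ => ?_).intervalIntegrable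
    rw [Set.uIcc_of_le hau] at hτ
    exact pow_ne_zero 2 (ha.trans_le hτ.1).ne'
  have hdiff : perronReal b κ u - perronReal b κ a = ∫ τ in a..u, r τ :=
    intervalIntegral.integral_interval_sub_left (hrc.intervalIntegrable _ _)
      (hrc.intervalIntegrable _ _)
  have hbr : Continuous fun τ => b * r τ := continuous_const.mul hrc
  rw [intervalIntegral.integral_sub (hbr.intervalIntegrable _ _)
    (hSc.intervalIntegrable _ _), intervalIntegral.integral_const_mul] at hFTC
  have hbpos : 0 < |b| := abs_pos.2 hb
  rw [hdiff, le_div_iff₀ (by positivity)]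
  have h1 : |b * ∫ τ in a..u, r τ| ≤ 2 / a := by
    have : b * ∫ τ in a..u, r τ = E u - E a + ∫ τ in a..u, S τ := by linarith
    rw [this]
    have := hEb u (ha.trans_le hau)
    have := hEb a ha
    calc _ ≤ |E u| + |E a| + |∫ τ in a..u, S τ| :=
          (abs_add_le _ _).trans (add_le_add_left (abs_sub _ _) _)
      _ ≤ 1 / u + 1 / a + (1 / a - 1 / u) := by gcongr
      _ = 2 / a := by ring
  rw [abs_mul, le_div_iff₀ ha] at h1
  linarith

theorem perronReal_le_taylor {b κ u : ℝ} (hκ : 0 < κ) (hu : 0 ≤ u) (hb : 0 ≤ b) :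
    perronReal b κ u ≤
      Real.pi / 2 + (b * u - (b * u) ^ 3 / 18 + (b * u) ^ 5 / 600) := by
  have hbound : perronReal b κ u ≤ ∫ τ in (0 : ℝ)..u, (κ / (κ ^ 2 + τ ^ 2) +
      (b - b ^ 3 * τ ^ 2 / 6 + b ^ 5 * τ ^ 4 / 120)) := by
    refine intervalIntegral.integral_mono_on hu
      ((continuous_perronReal_integrand b hκ).intervalIntegrable _ _)
      (((continuous_div_sq_add_sq hκ).add (by fun_prop)).intervalIntegrable _ _) fun τ hτ => ?_
    have hpos : 0 < κ ^ 2 + τ ^ 2 := by positivity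
    have hs := Real.sin_le_taylor_five (mul_nonneg hb hτ.1)
    rw [add_div]
    refine add_le_add (div_le_div_of_nonneg_right
      (by nlinarith [Real.cos_le_one (b * τ)]) hpos.le) ?_
    rw [div_le_iff₀ hpos]
    have hq : 0 ≤ b - b ^ 3 * τ ^ 2 / 6 + b ^ 5 * τ ^ 4 / 120 := by
      have : b - b ^ 3 * τ ^ 2 / 6 + b ^ 5 * τ ^ 4 / 120 =
          b * ((1 - (b * τ) ^ 2 / 12) ^ 2 + (b * τ) ^ 4 / 720) := by ring
      rw [this]
      positivity
    have := mul_le_mul_of_nonneg_left hs hτ.1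
    nlinarith [mul_nonneg hq (sq_nonneg κ)]
  refine hbound.trans ?_
  rw [intervalIntegral.integral_add ((continuous_div_sq_add_sq hκ).intervalIntegrable _ _)
    (Continuous.intervalIntegrable (by fun_prop) _ _), integral_zero_div_sq_add_sq]
  refine add_le_add (Real.arctan_lt_pi_div_two _).le (le_of_eq ?_)
  rw [intervalIntegral.integral_add (Continuous.intervalIntegrable (by fun_prop) _ _)
    (Continuous.intervalIntegrable (by fun_prop) _ _),
    intervalIntegral.integral_sub (Continuous.intervalIntegrable (by fun_prop) _ _)
    (Continuous.intervalIntegrable (by fun_prop) _ _)]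
  simp only [intervalIntegral.integral_const, intervalIntegral.integral_div,
    intervalIntegral.integral_const_mul, integral_pow, smul_eq_mul]
  norm_num
  ring


theorem Real.sub_inv_le_arctan {x : ℝ} (hx : 0 < x) : Real.pi / 2 - 1 / x ≤ Real.arctan x := by
  have h1 := Real.arctan_inv_of_pos hx
  have h2 : Real.arctan x⁻¹ ≤ x⁻¹ := by
    have h := Real.le_tan (x := Real.arctan x⁻¹)
      (Real.arctan_nonneg.2 (inv_nonneg.2 hx.le)) (Real.arctan_lt_pi_div_two _)
    rwa [Real.tan_arctan] at h
  rw [one_div]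
  linarith

theorem neg_perronReal_le {b κ u : ℝ} (hκ : 0 < κ) (hκb : κ * |b| ≤ 1) (hbu : 2 ≤ |b| * u) :
    Real.pi / 2 - 1 / 2 - 3 ≤ perronReal b κ u ∧
      (0 ≤ b → Real.pi / 2 - 1 / 2 - 1 ≤ perronReal b κ u) := by
  have hb : b ≠ 0 := by
    rintro rfl
    norm_num at hbu
  have hb' : 0 < |b| := abs_pos.2 hb
  set a := 2 / |b| with ha
  have ha0 : 0 < a := by positivity
  have hau : a ≤ u := by rw [ha, div_le_iff₀ hb']; linarith
  have hab : a * |b| = 2 := by rw [ha]; field_simp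
  have htail := abs_perronReal_sub_le hκ ha0 hau hb
  rw [hab, div_self two_ne_zero] at htail
  have h2 : 2 ≤ a / κ := by
    rw [ha, le_div_iff₀ hκ, le_div_iff₀ hb']
    nlinarith
  have harc : Real.pi / 2 - 1 / 2 ≤ Real.arctan (a / κ) :=
    (Real.sub_inv_le_arctan two_pos).trans (Real.arctan_mono h2)
  have hA := abs_perronReal_sub_arctan_le b hκ ha0.le
  rw [mul_comm, hab] at hA
  rw [abs_le] at htail hA
  refine ⟨by linarith, fun hb0 => ?_⟩
  rw [abs_of_nonneg hb0] at hκb hab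
  have := arctan_le_perronReal hκ ha0.le hb0 hκb (by linarith)
  linarith

theorem perronReal_le_of_nonpos {b κ u : ℝ} (hκ : 0 < κ) (hb : b ≤ 0) (hbu : 3 ≤ |b| * u) :
    perronReal b κ u ≤ Real.pi / 2 + 2 / 3 := by
  have hb0 : b ≠ 0 := by
    rintro rfl
    norm_num at hbu
  have hb' : 0 < |b| := abs_pos.2 hb0
  set a := 3 / |b| with ha
  have ha0 : 0 < a := by positivity
  have hau : a ≤ u := by rw [ha, div_le_iff₀ hb']; linarith
  have hab : a * |b| = 3 := by rw [ha]; field_simp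
  have htail := abs_perronReal_sub_le hκ ha0 hau hb0
  rw [hab] at htail
  have h1 := perronReal_le_arctan hκ ha0.le hb (by rw [← abs_of_nonpos hb]; linarith)
  have h2 := Real.arctan_lt_pi_div_two (a / κ)
  rw [abs_le] at htail
  linarith

theorem taylor_sub_nonneg {x y : ℝ} (hxy : y ≤ x) :
    y - y ^ 3 / 18 + y ^ 5 / 600 ≤ x - x ^ 3 / 18 + x ^ 5 / 600 := by
  have hder : ∀ t : ℝ, HasDerivAt (fun t : ℝ => t - t ^ 3 / 18 + t ^ 5 / 600)
      (1 - t ^ 2 / 6 + t ^ 4 / 120) t := by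
    intro t
    have h := ((hasDerivAt_id t).sub ((hasDerivAt_pow 3 t).div_const 18)).add
      ((hasDerivAt_pow 5 t).div_const 600)
    convert! h using 1
    norm_num
    ring
  refine monotone_of_deriv_nonneg (fun t => (hder t).differentiableAt) (fun t => ?_) hxy
  rw [(hder t).deriv]
  nlinarith [sq_nonneg (t ^ 2 - 10)]

theorem perronReal_le_of_nonneg {b κ u : ℝ} (hκ : 0 < κ) (hb : 0 ≤ b) (hbu : 4 ≤ b * u) :
    perronReal b κ u ≤ Real.pi / 2 + 266 / 100 := by
  have hb' : 0 < b := by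
    rcases hb.eq_or_lt with rfl | h
    · norm_num at hbu
    · exact h
  set a := 4 / b with ha
  have ha0 : 0 < a := by positivity
  have hau : a ≤ u := by rw [ha, div_le_iff₀ hb']; linarith
  have hab : a * b = 4 := by rw [ha]; field_simp
  have htail := abs_perronReal_sub_le hκ ha0 hau hb'.ne'
  rw [abs_of_pos hb', hab] at htail
  have h1 := perronReal_le_taylor hκ ha0.le hb
  rw [mul_comm b a, hab] at h1
  rw [abs_le] at htail
  norm_num at h1 htail
  linarith

theorem arctan_le_arctan_div {κ θ u : ℝ} (hκ : 0 < κ) (hκθ : κ * θ ≤ 1) (hu : 0 ≤ u) :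
    Real.arctan (θ * u) ≤ Real.arctan (u / κ) :=
  Real.arctan_mono (by rw [le_div_iff₀ hκ]; nlinarith)

theorem pi_div_four_le_arctan {x : ℝ} (hx : 1 ≤ x) : Real.pi / 4 ≤ Real.arctan x := by
  rw [← Real.arctan_one]
  exact Real.arctan_mono hx

theorem abs_perronReal_sub_le_of_nonneg_of_one_le {b κ θ u : ℝ} (hκ : 0 < κ) (hκθ : κ * θ ≤ 1)
    (hb : 0 ≤ b) (hbθ : b ≤ θ) (h1 : 1 ≤ θ) (hu : 1 ≤ u) :
    |perronReal b κ u - Real.pi / 2| ≤ θ * u := by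
  have hpi := Real.pi_gt_d4
  have hpi' := Real.pi_lt_d4
  have hκb : κ * b ≤ 1 := (mul_le_mul_of_nonneg_left hbθ hκ.le).trans hκθ
  have hu0 : 0 ≤ u := by linarith
  have hx1 : 1 ≤ θ * u := by nlinarith
  have hyx : b * u ≤ θ * u := mul_le_mul_of_nonneg_right hbθ hu0
  have harc := (pi_div_four_le_arctan hx1).trans (arctan_le_arctan_div hκ hκθ hu0)
  have hA1 := abs_le.1 (abs_perronReal_sub_arctan_le b hκ hu0)
  rw [abs_of_nonneg hb] at hA1
  have := Real.arctan_lt_pi_div_two (u / κ)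
  rw [abs_le]
  refine ⟨?_, by linarith⟩
  rcases le_or_gt (b * u) 2 with h2 | h2
  · have := arctan_le_perronReal hκ hu0 hb hκb h2
    linarith
  · have := (neg_perronReal_le (u := u) hκ (by rwa [abs_of_nonneg hb])
      (by rw [abs_of_nonneg hb]; exact h2.le)).2 hb
    linarith

theorem abs_perronReal_sub_le_of_neg_of_one_le {b κ θ u : ℝ} (hκ : 0 < κ) (hκθ : κ * θ ≤ 1)
    (hb : b < 0) (hbθ : |b| ≤ θ) (h1 : 1 ≤ θ) (hu : 1 ≤ u) :
    |perronReal b κ u - 7 / 10| ≤ θ * u := by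
  have hpi := Real.pi_gt_d4
  have hpi' := Real.pi_lt_d4
  have hu0 : 0 ≤ u := by linarith
  have hx1 : 1 ≤ θ * u := by nlinarith
  have hyx : |b| * u ≤ θ * u := mul_le_mul_of_nonneg_right hbθ hu0
  have harc := (pi_div_four_le_arctan hx1).trans (arctan_le_arctan_div hκ hκθ hu0)
  have hA1 := abs_le.1 (abs_perronReal_sub_arctan_le b hκ hu0)
  have := Real.arctan_lt_pi_div_two (u / κ)
  rw [abs_le]
  refine ⟨by linarith, ?_⟩
  rcases le_or_gt (|b| * u) 3 with h2 | h2
  · have := perronReal_le_arctan hκ hu0 hb.le (by rwa [← abs_of_neg hb])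
    linarith
  · have := perronReal_le_of_nonpos hκ hb.le h2.le
    linarith

theorem le_arctan_add_inv_sq {x : ℝ} (hx0 : 0 < x) :
    162 / 100 ≤ Real.arctan x + 3 / 4 * x + 1 / 4 * (1 / x ^ 2) := by
  have h3 := Real.three_mul_div_le_arctan hx0.le
  have : 3 * x / (3 + x ^ 2) + 3 / 4 * x + 1 / 4 * (1 / x ^ 2) - 162 / 100 =
      (75 / 100 * x ^ 5 - 162 / 100 * x ^ 4 + 525 / 100 * x ^ 3 -
        461 / 100 * x ^ 2 + 75 / 100) / ((3 + x ^ 2) * x ^ 2) := by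
    field_simp
    ring
  have hnum : 0 ≤ 75 / 100 * x ^ 5 - 162 / 100 * x ^ 4 + 525 / 100 * x ^ 3 -
        461 / 100 * x ^ 2 + 75 / 100 := by
    nlinarith [mul_nonneg hx0.le (sq_nonneg (x - 72 / 100)), sq_nonneg (x - 72 / 100),
      mul_nonneg hx0.le (sq_nonneg (x * (x - 72 / 100))), sq_nonneg (x * (x - 72 / 100))]
  have := div_nonneg hnum (by positivity : 0 ≤ (3 + x ^ 2) * x ^ 2)
  linarith

theorem taylor_le_of_le_four {x : ℝ} (hx0 : 0 < x) (hx : x ≤ 4) :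
    x - x ^ 3 / 18 + x ^ 5 / 600 - 49 / 1000 ≤ 3 / 4 * x + 1 / 4 * (1 / x) := by
  have : 3 / 4 * x + 1 / 4 * (1 / x) - (x - x ^ 3 / 18 + x ^ 5 / 600 - 49 / 1000) =
      (1 / 4 - 1 / 4 * x ^ 2 + x ^ 4 / 18 - x ^ 6 / 600 + 49 / 1000 * x) / x := by
    field_simp
    ring
  have hnum : 0 ≤ 1 / 4 - 1 / 4 * x ^ 2 + x ^ 4 / 18 - x ^ 6 / 600 +
      49 / 1000 * x := by
    nlinarith [mul_nonneg (mul_nonneg hx0.le (sub_nonneg.2 hx)) (sq_nonneg (x * (x - 155 / 100))),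
      mul_nonneg hx0.le (sq_nonneg (x - 155 / 100)), sq_nonneg (x - 155 / 100),
      sq_nonneg (x ^ 2 - 24 / 10),
      mul_nonneg (mul_nonneg hx0.le (sub_nonneg.2 hx)) (sq_nonneg (x - 155 / 100))]
  have := div_nonneg hnum hx0.le
  linarith

theorem abs_perronReal_sub_le_of_nonneg_of_le_one {b κ θ u R : ℝ} (hκ : 0 < κ) (hθ : 0 < θ)
    (hκθ : κ * θ ≤ 1) (hb : 0 ≤ b) (hbθ : b ≤ θ) (hu : 1 ≤ u)
    (hR1 : 1 / (θ * u) ≤ R) (hR2 : 1 / (θ * u) ^ 2 ≤ R) :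
    |perronReal b κ u - 162 / 100| ≤ 3 / 4 * (θ * u) + 1 / 4 * R := by
  have hpi := Real.pi_gt_d4
  have hpi' := Real.pi_lt_d4
  have hκb : κ * b ≤ 1 := (mul_le_mul_of_nonneg_left hbθ hκ.le).trans hκθ
  have hu0 : 0 ≤ u := by linarith
  have hyx : b * u ≤ θ * u := mul_le_mul_of_nonneg_right hbθ hu0
  have hAx := arctan_le_arctan_div hκ hκθ hu0
  have hx0 : 0 < θ * u := by positivity
  generalize θ * u = x at *
  have hRpos : 0 < R := lt_of_lt_of_le (by positivity) hR1
  rw [abs_le]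
  constructor
  · rcases le_or_gt (b * u) 2 with h2 | h2
    · have hp := arctan_le_perronReal hκ hu0 hb hκb h2
      rcases le_or_gt x 1 with hx | hx
      · have := le_arctan_add_inv_sq hx0
        linarith
      · have h3 := pi_div_four_le_arctan hx.le
        have key : 1 ≤ 3 / 4 * x + 1 / 4 * (1 / x) := by
          have : 3 / 4 * x + 1 / 4 * (1 / x) - 1 = (x - 1) * (3 * x - 1) / (4 * x) := by
            field_simp
            ring
          have := div_nonneg (mul_nonneg (by linarith) (by linarith) :
            0 ≤ (x - 1) * (3 * x - 1)) (by linarith : 0 ≤ 4 * x)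
          linarith
        linarith
    · have h3 := (neg_perronReal_le (u := u) hκ (by rwa [abs_of_nonneg hb])
        (by rw [abs_of_nonneg hb]; exact h2.le)).2 hb
      have key : 8 / 5 ≤ 3 / 4 * x + 1 / 4 * (1 / x) := by
        have : 3 / 4 * x + 1 / 4 * (1 / x) - 8 / 5 =
            (3 / 4 * x ^ 2 - 8 / 5 * x + 1 / 4) / x := by
          field_simp
          ring
        have := div_nonneg (by nlinarith : 0 ≤ 3 / 4 * x ^ 2 - 8 / 5 * x + 1 / 4) hx0.le
        linarith
      linarith
  · rcases le_or_gt (b * u) 4 with h4 | h4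
    · have hp := perronReal_le_taylor hκ hu0 hb
      rcases le_or_gt x 4 with hx | hx
      · have hT := taylor_sub_nonneg hyx
        have := taylor_le_of_le_four hx0 hx
        linarith
      · have hT := taylor_sub_nonneg h4
        norm_num at hT
        linarith
    · have := perronReal_le_of_nonneg hκ hb h4.le
      linarith

theorem le_arctan_add_of_le_one {x : ℝ} (hx0 : 0 < x) (hx1 : x ≤ 1) :
    7 / 10 + 15 / 100 * x ≤ Real.arctan x + 15 / 100 * (1 / x ^ 2) := by
  have h3 := Real.three_mul_div_le_arctan hx0.le
  have : 3 * x / (3 + x ^ 2) + 15 / 100 * (1 / x ^ 2) - (7 / 10 + 15 / 100 * x) =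
      (3 * x ^ 3 + 15 / 100 * (3 + x ^ 2) -
        (7 / 10 + 15 / 100 * x) * ((3 + x ^ 2) * x ^ 2)) / ((3 + x ^ 2) * x ^ 2) := by
    field_simp
  have hnum : 0 ≤ 3 * x ^ 3 + 15 / 100 * (3 + x ^ 2) -
      (7 / 10 + 15 / 100 * x) * ((3 + x ^ 2) * x ^ 2) := by
    nlinarith [mul_nonneg hx0.le (sq_nonneg (x - 8 / 10)), sq_nonneg (x - 8 / 10),
      mul_nonneg (sub_nonneg.2 hx1) (sq_nonneg x),
      mul_nonneg (sub_nonneg.2 hx1) (sq_nonneg (x * x)),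
      mul_nonneg (sub_nonneg.2 hx1) (mul_nonneg hx0.le (sq_nonneg x)),
      mul_nonneg (sub_nonneg.2 hx1) (sq_nonneg (x - 8 / 10))]
  have := div_nonneg hnum (by positivity : 0 ≤ (3 + x ^ 2) * x ^ 2)
  linarith

theorem le_arctan_add_of_one_le {x : ℝ} (hx1 : 1 ≤ x) (hx : x ≤ 31 / 10) :
    7 / 10 + 15 / 100 * x ≤ Real.arctan x + 15 / 100 * (1 / x) := by
  have hx0 : 0 < x := by linarith
  rcases le_or_gt x (13 / 10) with hx3 | hx3
  · have h3 := Real.three_mul_div_le_arctan hx0.le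
    have : 3 * x / (3 + x ^ 2) + 15 / 100 * (1 / x) - (7 / 10 + 15 / 100 * x) =
        (3 * x ^ 2 + 15 / 100 * (3 + x ^ 2) -
          (7 / 10 + 15 / 100 * x) * ((3 + x ^ 2) * x)) / ((3 + x ^ 2) * x) := by
      field_simp
    have hnum : 0 ≤ 3 * x ^ 2 + 15 / 100 * (3 + x ^ 2) -
        (7 / 10 + 15 / 100 * x) * ((3 + x ^ 2) * x) := by
      have h1 : 0 ≤ (x - 1) * (13 / 10 - x) := mul_nonneg (by linarith) (by linarith)
      have h2 := mul_nonneg (sub_nonneg.2 hx1) h1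
      have h3 := mul_nonneg (sub_nonneg.2 hx1) h2
      nlinarith
    have := div_nonneg hnum (by positivity : 0 ≤ (3 + x ^ 2) * x)
    linarith
  · have h4 := Real.sub_inv_le_arctan hx0
    have hpi := Real.pi_gt_d4
    have : 87 / 100 - (85 / 100 * (1 / x) + 15 / 100 * x) =
        (87 / 100 * x - 85 / 100 - 15 / 100 * x ^ 2) / x := by
      field_simp
      ring
    have hnum : 0 ≤ 87 / 100 * x - 85 / 100 - 15 / 100 * x ^ 2 := by nlinarith
    have := div_nonneg hnum hx0.le
    linarith

theorem abs_perronReal_sub_le_of_neg_of_le_one {b κ θ u R : ℝ} (hκ : 0 < κ) (hθ : 0 < θ)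
    (hκθ : κ * θ ≤ 1) (hb : b < 0) (hbθ : |b| ≤ θ) (hu : 1 ≤ u)
    (hR1 : 1 / (θ * u) ≤ R) (hR2 : 1 / (θ * u) ^ 2 ≤ R) :
    |perronReal b κ u - 7 / 10| ≤ 85 / 100 * (θ * u) + 15 / 100 * R := by
  have hpi := Real.pi_gt_d4
  have hpi' := Real.pi_lt_d4
  have hκb : κ * |b| ≤ 1 := (mul_le_mul_of_nonneg_left hbθ hκ.le).trans hκθ
  have hu0 : 0 ≤ u := by linarith
  have hyx : |b| * u ≤ θ * u := mul_le_mul_of_nonneg_right hbθ hu0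
  have hAx := arctan_le_arctan_div hκ hκθ hu0
  have hx0 : 0 < θ * u := by positivity
  generalize θ * u = x at *
  have hRpos : 0 < R := lt_of_lt_of_le (by positivity) hR1
  have hA1 := abs_le.1 (abs_perronReal_sub_arctan_le b hκ hu0)
  rw [abs_le]
  constructor
  · rcases le_or_gt (|b| * u) (31 / 10) with h3 | h3
    · rcases le_or_gt x 1 with hx | hx
      · have := le_arctan_add_of_le_one hx0 hx
        linarith
      · rcases le_or_gt x (31 / 10) with hx1 | hx1
        · have := le_arctan_add_of_one_le hx.le hx1
          linarith
        · have h4 := Real.sub_inv_le_arctan hx0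
          have : 1 / x ≤ 1 / (31 / 10) := one_div_le_one_div_of_le (by norm_num) hx1.le
          norm_num at this h4
          linarith
    · have := (neg_perronReal_le (u := u) hκ hκb (by linarith)).1
      linarith
  · rcases le_or_gt (|b| * u) 3 with h3 | h3
    · have hp := perronReal_le_arctan hκ hu0 hb.le (by rwa [← abs_of_neg hb])
      have := Real.arctan_lt_pi_div_two (u / κ)
      have key : 88 / 100 ≤ 85 / 100 * x + 15 / 100 * (1 / x ^ 2) := by
        have : 85 / 100 * x + 15 / 100 * (1 / x ^ 2) - 88 / 100 =
            (85 / 100 * x ^ 3 + 15 / 100 - 88 / 100 * x ^ 2) / x ^ 2 := by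
          field_simp
        have hnum : 0 ≤ 85 / 100 * x ^ 3 + 15 / 100 - 88 / 100 * x ^ 2 := by
          nlinarith [mul_nonneg hx0.le (sq_nonneg (x - 7 / 10)), sq_nonneg (x - 7 / 10)]
        have := div_nonneg hnum (by positivity : 0 ≤ x ^ 2)
        linarith
      linarith
    · have := perronReal_le_of_nonpos hκ hb.le h3.le
      linarith

/-- Uniform approximation of the truncated Perron kernel by a constant `d`, at a cost splitting
between a linear and a reciprocal term with weights `l` and `1 - l`. -/
theorem exists_perronReal_approx {b κ θ z : ℝ} (hκ : 0 < κ) (hθ : 0 < θ) (hκθ : κ * θ ≤ 1)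
    (hbθ : |b| ≤ θ) (hz0 : 0 ≤ z) (hz1 : z ≤ 1) (hzb : b < 0 → z = 0) :
    ∃ d l : ℝ, 0 ≤ l ∧ l ≤ 1 ∧ |z - d / Real.pi| ≤ l ∧ (1 < θ → l = 1) ∧
      ∀ u, 1 ≤ u → |perronReal b κ u - d| ≤ l * (θ * u) + (1 - l) * (1 / (θ ^ 2 * u)) := by
  have hpi := Real.pi_gt_d4
  have hpi' := Real.pi_lt_d4
  have hd : ∀ d l : ℝ, |z * Real.pi - d| ≤ l * Real.pi → |z - d / Real.pi| ≤ l := by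
    intro d l h
    have : z - d / Real.pi = (z * Real.pi - d) / Real.pi := by field_simp
    rw [this, abs_div, abs_of_pos Real.pi_pos, div_le_iff₀ Real.pi_pos]
    exact h
  have hR1 : ∀ u, 1 ≤ u → θ ≤ 1 → 1 / (θ * u) ≤ 1 / (θ ^ 2 * u) := fun u hu h1 =>
    one_div_le_one_div_of_le (by positivity) (by nlinarith [mul_pos hθ (by linarith : 0 < u)])
  have hR2 : ∀ u, 1 ≤ u → 1 / (θ * u) ^ 2 ≤ 1 / (θ ^ 2 * u) := fun u hu =>
    one_div_le_one_div_of_le (by positivity) (by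
      rw [mul_pow]
      exact mul_le_mul_of_nonneg_left (by nlinarith) (by positivity))
  rcases lt_or_ge 1 θ with h1 | h1
  · rcases le_or_gt 0 b with hb | hb
    · rw [abs_of_nonneg hb] at hbθ
      refine ⟨Real.pi / 2, 1, zero_le_one, le_rfl, hd _ _ ?_, fun _ => rfl, fun u hu => ?_⟩
      · rw [abs_le]; constructor <;> nlinarith
      · rw [sub_self, zero_mul, add_zero, one_mul]
        exact abs_perronReal_sub_le_of_nonneg_of_one_le hκ hκθ hb hbθ h1.le hu
    · refine ⟨7 / 10, 1, zero_le_one, le_rfl, hd _ _ ?_, fun _ => rfl, fun u hu => ?_⟩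
      · rw [hzb hb, abs_le]; constructor <;> linarith
      · rw [sub_self, zero_mul, add_zero, one_mul]
        exact abs_perronReal_sub_le_of_neg_of_one_le hκ hκθ hb hbθ h1.le hu
  · rcases le_or_gt 0 b with hb | hb
    · rw [abs_of_nonneg hb] at hbθ
      refine ⟨162 / 100, 3 / 4, by norm_num, by norm_num, hd _ _ ?_,
        fun h => absurd h h1.not_gt, fun u hu => ?_⟩
      · rw [abs_le]; constructor <;> nlinarith
      · refine (abs_perronReal_sub_le_of_nonneg_of_le_one hκ hθ hκθ hb hbθ hu (hR1 u hu h1)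
          (hR2 u hu)).trans_eq (by norm_num)
    · refine ⟨7 / 10, 85 / 100, by norm_num, by norm_num, hd _ _ ?_,
        fun h => absurd h h1.not_gt, fun u hu => ?_⟩
      · rw [hzb hb, abs_le]; constructor <;> linarith
      · refine (abs_perronReal_sub_le_of_neg_of_le_one hκ hθ hκθ hb hbθ hu (hR1 u hu h1)
          (hR2 u hu)).trans_eq (by norm_num)

theorem continuous_perronReal (b : ℝ) {κ : ℝ} (hκ : 0 < κ) : Continuous (perronReal b κ) :=
  intervalIntegral.continuous_primitive
    (fun _ _ => (continuous_perronReal_integrand b hκ).intervalIntegrable _ _) 0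

theorem IsAdmissible.continuousOn {k : ℕ} {ξ : ℝ} {w : ℝ → ℝ} (hw : IsAdmissible k ξ w)
    (hk : 1 ≤ k) : ContinuousOn w (Set.Icc 1 ξ) := by
  have := (hw.diff 0 hk).continuousOn
  rwa [iteratedDeriv_zero] at this

theorem integral_abs_div_nonneg {ξ : ℝ} (hξ : 1 ≤ ξ) (f : ℝ → ℝ) :
    0 ≤ ∫ u in (1:ℝ)..ξ, |f u| / u :=
  intervalIntegral.integral_nonneg hξ fun _ hu =>
    div_nonneg (abs_nonneg _) (zero_le_one.trans hu.1)

theorem integral_abs_div_le_Nkxi (k : ℕ) {ξ : ℝ} (hξ : 1 ≤ ξ) (w : ℝ → ℝ) :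
    (1 / Real.pi) * ∫ u in (1:ℝ)..ξ, |w u| / u ≤ 2 * Nkxi k ξ w := by
  have hpi := Real.pi_pos
  have hξ0 : 0 < ξ := by linarith
  have h1 : (∫ u in (1:ℝ)..ξ, |w u| / u) ≤ (k.factorial : ℝ) *
      ∑ h ∈ Finset.range (k + 1),
        (1 / (h.factorial : ℝ)) * ∫ u in (1:ℝ)..ξ, |iteratedDeriv h w u| / u := by
    have h2 := Finset.single_le_sum (f := fun h : ℕ =>
      (1 / (h.factorial : ℝ)) * ∫ u in (1:ℝ)..ξ, |iteratedDeriv h w u| / u)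
      (fun h _ => mul_nonneg (by positivity) (integral_abs_div_nonneg hξ _))
      (Finset.mem_range.2 (Nat.succ_pos k))
    simp only [Nat.factorial_zero, Nat.cast_one, div_one, one_mul, iteratedDeriv_zero] at h2
    refine h2.trans (le_mul_of_one_le_left ?_ (by exact_mod_cast k.factorial_pos))
    exact (integral_abs_div_nonneg hξ w).trans h2
  have h3 : 0 ≤ |iteratedDeriv (k - 1) w ξ| / ξ := by positivity
  have h4 := abs_nonneg (iteratedDeriv (k - 1) w 1)
  rw [Nkxi]
  calc _ ≤ (1 / Real.pi) * (|iteratedDeriv (k - 1) w ξ| / ξ + |iteratedDeriv (k - 1) w 1| +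
        (k.factorial : ℝ) * ∑ h ∈ Finset.range (k + 1),
          (1 / (h.factorial : ℝ)) * ∫ u in (1:ℝ)..ξ, |iteratedDeriv h w u| / u) :=
        mul_le_mul_of_nonneg_left (by linarith) (by positivity)
    _ = _ := by field_simp

theorem abs_integral_mul_le_Lxi {k : ℕ} (hk : 1 ≤ k) {ξ : ℝ} (hξ : 1 < ξ) {w : ℝ → ℝ}
    (hw : IsAdmissible k ξ w) {p : ℝ → ℝ} {α β : ℝ}
    (hp : ∀ u, 1 ≤ u → |p u| ≤ α * u + β * (1 / u)) :
    |(1 / Real.pi) * ∫ u in (1:ℝ)..ξ, p u * w u| ≤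
      α * Lxi ξ w + β * ((1 / Real.pi) * ∫ u in (1:ℝ)..ξ, |w u| / u) := by
  have hwc := hw.continuousOn hk
  have hne : ∀ u ∈ Set.Icc 1 ξ, u ≠ 0 := fun u hu => (zero_lt_one.trans_le hu.1).ne'
  have hi1 : IntervalIntegrable (fun u => u * |w u|) volume 1 ξ :=
    ContinuousOn.intervalIntegrable_of_Icc hξ.le (continuousOn_id.mul hwc.abs)
  have hi2 : IntervalIntegrable (fun u => |w u| / u) volume 1 ξ :=
    ContinuousOn.intervalIntegrable_of_Icc hξ.le (hwc.abs.div continuousOn_id hne)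
  have h : |∫ u in (1:ℝ)..ξ, p u * w u| ≤
      ∫ u in (1:ℝ)..ξ, (α * (u * |w u|) + β * (|w u| / u)) := by
    rw [← Real.norm_eq_abs]
    refine intervalIntegral.norm_integral_le_of_norm_le hξ.le (Filter.Eventually.of_forall
      fun u hu => ?_) ((hi1.const_mul _).add (hi2.const_mul _))
    rw [norm_mul, Real.norm_eq_abs, Real.norm_eq_abs]
    exact (mul_le_mul_of_nonneg_right (hp u hu.1.le) (abs_nonneg _)).trans_eq (by ring)
  rw [intervalIntegral.integral_add (hi1.const_mul _) (hi2.const_mul _),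
    intervalIntegral.integral_const_mul, intervalIntegral.integral_const_mul] at h
  rw [abs_mul, abs_of_pos (by positivity : 0 < 1 / Real.pi), Lxi]
  exact (mul_le_mul_of_nonneg_left h (by positivity)).trans_eq (by ring)

/-- The smoothed Perron error in the short range `|b| ≤ θ`. -/
theorem abs_sub_integral_perronReal_le {k : ℕ} (hk : 1 ≤ k) {ξ : ℝ} (hξ : 1 < ξ) {w : ℝ → ℝ}
    (hw : IsAdmissible k ξ w) {b κ θ z : ℝ} (hκ : 0 < κ) (hθ : 0 < θ)
    (hθ' : 2 * Nkxi k ξ w / θ ^ (k + 1) = 1 + θ * Lxi ξ w)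
    (hbθ : |b| ≤ θ) (hz0 : 0 ≤ z) (hz1 : z ≤ 1) (hzb : b < 0 → z = 0) :
    |z - (1 / Real.pi) * ∫ u in (1:ℝ)..ξ, perronReal b κ u * w u| ≤ 1 + θ * Lxi ξ w := by
  have hpi := Real.pi_pos
  have hwc := hw.continuousOn hk
  have hL : 0 ≤ Lxi ξ w := mul_nonneg (by positivity)
    (intervalIntegral.integral_nonneg hξ.le fun u hu =>
      mul_nonneg (zero_le_one.trans hu.1) (abs_nonneg _))
  have hpc := continuous_perronReal b hκ
  rcases le_or_gt (κ * θ) 1 with hκθ | hκθ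
  · obtain ⟨d, l, hl0, hl1, hzd, hlθ, hp⟩ :=
      exists_perronReal_approx hκ hθ hκθ hbθ hz0 hz1 hzb
    have hsplit : z - (1 / Real.pi) * ∫ u in (1:ℝ)..ξ, perronReal b κ u * w u =
        (z - d / Real.pi) - (1 / Real.pi) * ∫ u in (1:ℝ)..ξ, (perronReal b κ u - d) * w u := by
      have hi1 : IntervalIntegrable (fun u => perronReal b κ u * w u) volume 1 ξ :=
        ContinuousOn.intervalIntegrable_of_Icc hξ.le (hpc.continuousOn.mul hwc)
      have hi2 : IntervalIntegrable (fun u => d * w u) volume 1 ξ :=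
        ContinuousOn.intervalIntegrable_of_Icc hξ.le (continuousOn_const.mul hwc)
      simp only [sub_mul]
      rw [intervalIntegral.integral_sub hi1 hi2, intervalIntegral.integral_const_mul, hw.normal]
      ring
    have hint := abs_integral_mul_le_Lxi hk hξ hw (p := fun u => perronReal b κ u - d)
      (α := l * θ) (β := (1 - l) / θ ^ 2) fun u hu =>
        (hp u hu).trans_eq (by rw [one_div, one_div, mul_inv]; ring)
    have hN := integral_abs_div_le_Nkxi k hξ.le w
    have hI : 0 ≤ (1 / Real.pi) * ∫ u in (1:ℝ)..ξ, |w u| / u :=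
      mul_nonneg (by positivity) (integral_abs_div_nonneg hξ.le w)
    have hsecond : (1 - l) / θ ^ 2 * ((1 / Real.pi) * ∫ u in (1:ℝ)..ξ, |w u| / u) ≤
        (1 - l) * (1 + θ * Lxi ξ w) := by
      rcases lt_or_ge 1 θ with h1 | h1
      · simp [hlθ h1]
      · rw [← hθ', div_mul_eq_mul_div, mul_div_assoc]
        refine mul_le_mul_of_nonneg_left ?_ (by linarith)
        calc _ ≤ 2 * Nkxi k ξ w / θ ^ 2 := div_le_div_of_nonneg_right hN (by positivity)
          _ ≤ _ := div_le_div_of_nonneg_left (hI.trans hN) (by positivity)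
            (pow_le_pow_of_le_one hθ.le h1 (by omega))
    rw [hsplit]
    calc _ ≤ |z - d / Real.pi| +
          |(1 / Real.pi) * ∫ u in (1:ℝ)..ξ, (perronReal b κ u - d) * w u| := abs_sub _ _
      _ ≤ l + (l * θ * Lxi ξ w + (1 - l) * (1 + θ * Lxi ξ w)) :=
          add_le_add hzd (hint.trans (add_le_add_right hsecond _))
      _ = _ := by ring
  · have hint := abs_integral_mul_le_Lxi hk hξ hw (p := perronReal b κ)
      (α := 1 / κ) (β := 0) fun u hu =>
        (abs_perronReal_le_div b hκ (by linarith)).trans_eq (by ring)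
    have h1 : 1 / κ ≤ θ := by rw [div_le_iff₀ hκ]; linarith
    calc _ ≤ |z| + |(1 / Real.pi) * ∫ u in (1:ℝ)..ξ, perronReal b κ u * w u| := abs_sub _ _
      _ ≤ 1 + (1 / κ * Lxi ξ w + 0) := by
          refine add_le_add (by rwa [abs_of_nonneg hz0]) (hint.trans_eq (by ring))
      _ ≤ 1 + θ * Lxi ξ w := by
          rw [add_zero]
          gcongr

theorem ofReal_add_mul_I_ne_zero {κ τ : ℝ} (h : κ ≠ 0 ∨ τ ≠ 0) :
    (κ : ℂ) + τ * Complex.I ≠ 0 := by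
  intro h0
  have hre := congrArg Complex.re h0
  have him := congrArg Complex.im h0
  simp at hre him
  tauto

theorem cexp_ofReal_mul (b κ τ : ℝ) :
    Complex.exp (b * ((κ : ℂ) + τ * Complex.I)) =
      Real.exp (b * κ) * (Real.cos (b * τ) + Real.sin (b * τ) * Complex.I) := by
  have : (b : ℂ) * ((κ : ℂ) + τ * Complex.I) =
      ((b * κ : ℝ) : ℂ) + ((b * τ : ℝ) : ℂ) * Complex.I := by
    push_cast
    ring
  rw [this, Complex.exp_add, Complex.exp_mul_I]
  push_cast
  rfl

theorem integral_cexp_div_vertical (b : ℝ) {κ : ℝ} (hκ : κ ≠ 0) (u : ℝ) :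
    ∫ τ in (-u)..u, Complex.exp (b * ((κ : ℂ) + τ * Complex.I)) / ((κ : ℂ) + τ * Complex.I) =
      ((2 * (Real.exp (b * κ) * perronReal b κ u) : ℝ) : ℂ) := by
  set g : ℝ → ℂ := fun τ =>
    Complex.exp (b * ((κ : ℂ) + τ * Complex.I)) / ((κ : ℂ) + τ * Complex.I) with hg
  have hgc : Continuous g := Continuous.div (by fun_prop) (by fun_prop) fun τ =>
    ofReal_add_mul_I_ne_zero (Or.inl hκ)
  have hgn : Continuous fun τ => g (-τ) := hgc.comp continuous_neg
  have hneg : ∫ τ in (-u)..0, g τ = ∫ τ in (0 : ℝ)..u, g (-τ) := by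
    rw [intervalIntegral.integral_comp_neg, neg_zero]
  rw [← intervalIntegral.integral_add_adjacent_intervals (b := 0) (hgc.intervalIntegrable _ _)
    (hgc.intervalIntegrable _ _), hneg, ← intervalIntegral.integral_add
      (hgn.intervalIntegrable _ _) (hgc.intervalIntegrable _ _),
    perronReal, ← intervalIntegral.integral_const_mul, ← intervalIntegral.integral_const_mul,
    ← intervalIntegral.integral_ofReal]
  congr 1
  ext τ
  have h1 : (κ : ℂ) + τ * Complex.I ≠ 0 := ofReal_add_mul_I_ne_zero (Or.inl hκ)
  have h2 : (κ : ℂ) - τ * Complex.I ≠ 0 := by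
    have := ofReal_add_mul_I_ne_zero (κ := κ) (τ := -τ) (Or.inl hκ)
    push_cast at this
    rwa [neg_mul, ← sub_eq_add_neg] at this
  have h3 : (κ : ℂ) ^ 2 + (τ : ℂ) ^ 2 = (κ + τ * Complex.I) * (κ - τ * Complex.I) := by
    linear_combination (τ : ℂ) ^ 2 * Complex.I_sq
  simp only [hg, cexp_ofReal_mul]
  push_cast
  rw [h3]
  simp only [mul_neg, Complex.cos_neg, Complex.sin_neg, neg_mul, ← sub_eq_add_neg]
  field_simp
  linear_combination (-2 * τ * Complex.sin (b * τ)) * Complex.I_sq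

theorem integral_one_div_vertical {κ : ℝ} (hκ : κ ≠ 0) (u : ℝ) :
    ∫ τ in (-u)..u, 1 / ((κ : ℂ) + τ * Complex.I) = ((2 * Real.arctan (u / κ) : ℝ) : ℂ) := by
  have h := integral_cexp_div_vertical 0 hκ u
  have hp : perronReal 0 κ u = Real.arctan (u / κ) := by
    rw [← integral_zero_div_sq_add_sq, perronReal]
    simp
  rw [hp] at h
  simpa using h

theorem arctan_div_add_arctan_div {κ u : ℝ} (hu : 0 < u) (hκ : κ ≠ 0) :
    Real.arctan (u / κ) + Real.arctan (κ / u) = if 0 < κ then Real.pi / 2 else -(Real.pi / 2) := by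
  rw [← inv_div]
  split_ifs with h
  · rw [Real.arctan_inv_of_pos (by positivity)]
    ring
  · have : κ < 0 := lt_of_le_of_ne (not_lt.1 h) hκ
    rw [Real.arctan_inv_of_neg (div_neg_of_neg_of_pos this hu)]
    ring

/-- Moving the truncated Perron integral from one vertical line to another. -/
theorem perronReal_sub_perronReal (b : ℝ) {κ₁ κ₂ u : ℝ} (h1 : κ₁ ≠ 0) (h2 : κ₂ ≠ 0)
    (hu : 0 < u) :
    Real.exp (b * κ₂) * perronReal b κ₂ u - Real.exp (b * κ₁) * perronReal b κ₁ u =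
      (∫ σ in κ₁..κ₂, (Complex.exp (b * ((σ : ℂ) + u * Complex.I)) /
        ((σ : ℂ) + u * Complex.I)).im) +
      ((if 0 < κ₂ then Real.pi / 2 else -(Real.pi / 2)) -
        (if 0 < κ₁ then Real.pi / 2 else -(Real.pi / 2))) := by
  set G : ℂ → ℂ := dslope (fun s : ℂ => Complex.exp (b * s)) 0 with hG
  have hGd : Differentiable ℂ G := by
    have : DifferentiableOn ℂ (fun s : ℂ => Complex.exp (b * s)) Set.univ := by fun_prop
    rw [← Complex.differentiableOn_dslope (c := 0) Filter.univ_mem] at this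
    exact differentiableOn_univ.1 this
  have hGs : ∀ s : ℂ, s ≠ 0 → G s = Complex.exp (b * s) / s - 1 / s := by
    intro s hs
    rw [hG, dslope_of_ne _ hs, slope_def_field]
    simp [sub_div]
  have hrect := Complex.integral_boundary_rect_eq_zero_of_differentiableOn G
    ⟨κ₁, -u⟩ ⟨κ₂, u⟩ hGd.differentiableOn
  simp only [smul_eq_mul] at hrect
  have hvert : ∀ κ : ℝ, κ ≠ 0 → ∫ τ in (-u)..u, G ((κ : ℂ) + τ * Complex.I) =
      ((2 * (Real.exp (b * κ) * perronReal b κ u) - 2 * Real.arctan (u / κ) : ℝ) : ℂ) := by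
    intro κ hκ
    have hc1 : Continuous fun τ : ℝ =>
        Complex.exp (b * ((κ : ℂ) + τ * Complex.I)) / ((κ : ℂ) + τ * Complex.I) :=
      Continuous.div (by fun_prop) (by fun_prop) fun τ => ofReal_add_mul_I_ne_zero (Or.inl hκ)
    have hc2 : Continuous fun τ : ℝ => 1 / ((κ : ℂ) + τ * Complex.I) :=
      Continuous.div (by fun_prop) (by fun_prop) fun τ => ofReal_add_mul_I_ne_zero (Or.inl hκ)
    rw [Complex.ofReal_sub, ← integral_cexp_div_vertical b hκ, ← integral_one_div_vertical hκ,
      ← intervalIntegral.integral_sub (hc1.intervalIntegrable _ _) (hc2.intervalIntegrable _ _)]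
    congr 1
    ext τ
    exact hGs _ (ofReal_add_mul_I_ne_zero (Or.inl hκ))
  have hhor : (∫ σ in κ₁..κ₂, G ((σ : ℂ) + ((-u : ℝ) : ℂ) * Complex.I)) -
      (∫ σ in κ₁..κ₂, G ((σ : ℂ) + (u : ℂ) * Complex.I)) =
      -(2 * Complex.I) * ((∫ σ in κ₁..κ₂, (Complex.exp (b * ((σ : ℂ) + u * Complex.I)) /
        ((σ : ℂ) + u * Complex.I)).im) + (Real.arctan (κ₂ / u) - Real.arctan (κ₁ / u)) : ℝ) := by
    have hc : ∀ v : ℝ, Continuous fun σ : ℝ => G ((σ : ℂ) + (v : ℂ) * Complex.I) := fun v =>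
      hGd.continuous.comp (by fun_prop)
    have hne : ∀ σ : ℝ, (σ : ℂ) + (u : ℂ) * Complex.I ≠ 0 := fun σ =>
      ofReal_add_mul_I_ne_zero (Or.inr hu.ne')
    have hci : Continuous fun σ : ℝ => (Complex.exp (b * ((σ : ℂ) + u * Complex.I)) /
        ((σ : ℂ) + u * Complex.I)).im :=
      Complex.continuous_im.comp (Continuous.div (by fun_prop) (by fun_prop) hne)
    have hca : Continuous fun σ : ℝ => u / (u ^ 2 + σ ^ 2) :=
      Continuous.div (by fun_prop) (by fun_prop) fun σ => by positivity
    rw [← intervalIntegral.integral_sub ((hc (-u)).intervalIntegrable _ _)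
      ((hc u).intervalIntegrable _ _), ← integral_div_sq_add_sq,
      ← intervalIntegral.integral_add (hci.intervalIntegrable _ _) (hca.intervalIntegrable _ _),
      ← intervalIntegral.integral_ofReal, ← intervalIntegral.integral_const_mul]
    congr 1
    ext σ
    have hconj : (σ : ℂ) + ((-u : ℝ) : ℂ) * Complex.I =
        (starRingEnd ℂ) ((σ : ℂ) + (u : ℂ) * Complex.I) := by
      simp
    rw [hGs _ (hne σ), hGs _ (by rw [hconj]; exact (map_ne_zero _).2 (hne σ)), hconj]
    set s : ℂ := (σ : ℂ) + (u : ℂ) * Complex.I with hs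
    have e1 : Complex.exp (b * (starRingEnd ℂ) s) / (starRingEnd ℂ) s - 1 / (starRingEnd ℂ) s =
        (starRingEnd ℂ) (Complex.exp (b * s) / s - 1 / s) := by
      simp [← Complex.exp_conj]
    have e2 : (1 / s).im = -(u / (u ^ 2 + σ ^ 2)) := by
      rw [one_div, Complex.inv_im, Complex.normSq_apply]
      simp [hs]
      ring
    rw [e1]
    set q := Complex.exp (b * s) / s
    have e3 : q.im + u / (u ^ 2 + σ ^ 2) = (q - 1 / s).im := by
      rw [Complex.sub_im, e2]
      ring
    rw [e3]
    apply Complex.ext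
    · simp
    · simp
      ring
  rw [hhor, hvert κ₂ h2, hvert κ₁ h1] at hrect
  have him := congrArg Complex.im hrect
  simp only [Complex.add_im, Complex.sub_im, Complex.mul_im, Complex.neg_im, Complex.I_im,
    Complex.I_re, Complex.ofReal_re, Complex.ofReal_im, Complex.neg_re, Complex.mul_re] at him
  norm_num at him
  have e1 := arctan_div_add_arctan_div hu h1
  have e2 := arctan_div_add_arctan_div hu h2
  rw [← e1, ← e2]
  linarith

/-- The `m`-th derivative of `u ↦ 1 / (σ + iu)`. -/
noncomputable def invDeriv (σ : ℝ) (m : ℕ) (u : ℝ) : ℂ :=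
  (-Complex.I) ^ m * (m.factorial : ℂ) / ((σ : ℂ) + u * Complex.I) ^ (m + 1)

theorem hasDerivAt_invDeriv (σ : ℝ) (m : ℕ) {u : ℝ} (hu : 0 < u) :
    HasDerivAt (invDeriv σ m) (invDeriv σ (m + 1) u) u := by
  have hne : (σ : ℂ) + u * Complex.I ≠ 0 := ofReal_add_mul_I_ne_zero (Or.inr hu.ne')
  have hlin : HasDerivAt (fun u : ℝ => (σ : ℂ) + u * Complex.I) Complex.I u := by
    simpa using ((hasDerivAt_id u).ofReal_comp.mul_const Complex.I).const_add (σ : ℂ)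
  have h := ((hlin.pow (m + 1)).inv (pow_ne_zero _ hne)).const_mul
    ((-Complex.I) ^ m * (m.factorial : ℂ))
  convert! h using 1
  rw [invDeriv, Nat.factorial_succ]
  push_cast
  simp only [Pi.pow_apply]
  generalize (σ : ℂ) + u * Complex.I = s at hne
  field_simp
  ring

theorem norm_invDeriv_le (σ : ℝ) (m : ℕ) {u : ℝ} (hu : 1 ≤ u) :
    ‖invDeriv σ m u‖ ≤ m.factorial / u := by
  have hu0 : 0 < u := by linarith
  have h1 : u ≤ ‖(σ : ℂ) + u * Complex.I‖ := by
    have := Complex.abs_im_le_norm ((σ : ℂ) + u * Complex.I)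
    simp at this
    exact (le_abs_self u).trans this
  have h2 : u ≤ ‖(σ : ℂ) + u * Complex.I‖ ^ (m + 1) :=
    h1.trans (le_self_pow₀ (hu.trans h1) (Nat.succ_ne_zero m))
  rw [invDeriv, norm_div, norm_mul, norm_pow, norm_pow, norm_neg, Complex.norm_I, one_pow,
    one_mul, Complex.norm_natCast]
  exact div_le_div_of_nonneg_left (by positivity) hu0 h2

/-- The `j`-th derivative of `u ↦ w u / (σ + iu)`, by the Leibniz rule. -/
noncomputable def leibnizSum (w : ℝ → ℝ) (σ : ℝ) (j : ℕ) (u : ℝ) : ℂ :=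
  ∑ h ∈ Finset.range (j + 1),
    (j.choose h : ℂ) * (((iteratedDeriv h w u : ℝ) : ℂ) * invDeriv σ (j - h) u)

section LeibnizSum

variable {k : ℕ} {ξ : ℝ} {w : ℝ → ℝ}

theorem IsAdmissible.hasDerivAt (hw : IsAdmissible k ξ w) {h : ℕ} (hh : h < k) {u : ℝ}
    (hu : u ∈ Set.Ioo 1 ξ) : HasDerivAt (iteratedDeriv h w) (iteratedDeriv (h + 1) w u) u := by
  rw [iteratedDeriv_succ]
  exact ((hw.diff h hh).differentiableAt (Icc_mem_nhds hu.1 hu.2)).hasDerivAt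

theorem IsAdmissible.hasDerivAt_leibnizSum (hw : IsAdmissible k ξ w) (σ : ℝ) {j : ℕ}
    (hj : j < k) {u : ℝ} (hu : u ∈ Set.Ioo 1 ξ) :
    HasDerivAt (leibnizSum w σ j) (leibnizSum w σ (j + 1) u) u := by
  have hu0 : 0 < u := by linarith [hu.1]
  have h : HasDerivAt (leibnizSum w σ j) (∑ h ∈ Finset.range (j + 1),
      (j.choose h : ℂ) * (((iteratedDeriv (h + 1) w u : ℝ) : ℂ) * invDeriv σ (j - h) u +
        ((iteratedDeriv h w u : ℝ) : ℂ) * invDeriv σ (j - h + 1) u)) u := by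
    refine HasDerivAt.fun_sum fun h hh => ?_
    have hh' : h < k := by
      have := Finset.mem_range.1 hh
      omega
    exact (((hw.hasDerivAt hh' hu).ofReal_comp).mul (hasDerivAt_invDeriv σ _ hu0)).const_mul _
  convert! h using 1
  rw [leibnizSum, Finset.sum_choose_succ_mul
    (fun i j => ((iteratedDeriv i w u : ℝ) : ℂ) * invDeriv σ j u), ← Finset.sum_add_distrib]
  refine Finset.sum_congr rfl fun h hh => ?_
  have : j + 1 - h = j - h + 1 := by
    have := Finset.mem_range.1 hh
    omega
  rw [this]
  ring

theorem continuousOn_invDeriv (σ : ℝ) (m : ℕ) (ξ : ℝ) :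
    ContinuousOn (invDeriv σ m) (Set.Icc 1 ξ) := fun u hu =>
  (hasDerivAt_invDeriv σ m (by linarith [hu.1])).continuousAt.continuousWithinAt

theorem IsAdmissible.continuousOn_leibnizSum (hw : IsAdmissible k ξ w) (σ : ℝ) {j : ℕ}
    (hj : j < k) : ContinuousOn (leibnizSum w σ j) (Set.Icc 1 ξ) := by
  refine continuousOn_finsetSum _ fun h hh => continuousOn_const.mul
    (ContinuousOn.mul ?_ (continuousOn_invDeriv σ _ ξ))
  have hh' : h < k := by
    have := Finset.mem_range.1 hh
    omega
  exact Complex.continuous_ofReal.comp_continuousOn (hw.diff h hh').continuousOn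

theorem IsAdmissible.intervalIntegrable (hw : IsAdmissible k ξ w) (hξ : 1 ≤ ξ) {h : ℕ}
    (hh : h ≤ k) : IntervalIntegrable (iteratedDeriv h w) volume 1 ξ := by
  rcases hh.lt_or_eq with hh | rfl
  · exact (hw.diff h hh).continuousOn.intervalIntegrable_of_Icc hξ
  · exact (intervalIntegrable_iff_integrableOn_Icc_of_le hξ).2 hw.integ

theorem IsAdmissible.intervalIntegrable_leibnizSum (hw : IsAdmissible k ξ w) (hξ : 1 ≤ ξ)
    (σ : ℝ) {j : ℕ} (hj : j ≤ k) : IntervalIntegrable (leibnizSum w σ j) volume 1 ξ := by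
  have : leibnizSum w σ j = ∑ h ∈ Finset.range (j + 1), fun u =>
      (j.choose h : ℂ) * (((iteratedDeriv h w u : ℝ) : ℂ) * invDeriv σ (j - h) u) := by
    ext u
    simp [leibnizSum]
  rw [this]
  refine IntervalIntegrable.sum _ fun h hh =>
    (IntervalIntegrable.mul_continuousOn ?_ ?_).const_mul _
  · have hh' : h ≤ k := by
      have := Finset.mem_range.1 hh
      omega
    have hi := hw.intervalIntegrable hξ hh'
    exact ⟨hi.1.ofReal, hi.2.ofReal⟩
  · rw [Set.uIcc_of_le hξ]
    exact continuousOn_invDeriv σ _ ξ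

theorem IsAdmissible.leibnizSum_endpoint (hw : IsAdmissible k ξ w) (σ : ℝ) {j : ℕ}
    (hj : j + 2 ≤ k) : leibnizSum w σ j 1 = 0 ∧ leibnizSum w σ j ξ = 0 := by
  constructor
  all_goals
    refine Finset.sum_eq_zero fun h hh => ?_
    have hh' : h + 2 ≤ k := by
      have := Finset.mem_range.1 hh
      omega
    simp [hw.boundary h hh']

theorem norm_leibnizSum_le_of_forall_eq_zero (w : ℝ → ℝ) (σ : ℝ) {j : ℕ} {u : ℝ} (hu : 1 ≤ u)
    (h0 : ∀ h < j, iteratedDeriv h w u = 0) :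
    ‖leibnizSum w σ j u‖ ≤ |iteratedDeriv j w u| / u := by
  rw [leibnizSum, Finset.sum_eq_single_of_mem j (Finset.self_mem_range_succ j)]
  · rw [Nat.choose_self, Nat.cast_one, one_mul, Nat.sub_self, norm_mul, Complex.norm_real,
      Real.norm_eq_abs, div_eq_mul_one_div]
    exact mul_le_mul_of_nonneg_left (by simpa using norm_invDeriv_le σ 0 hu) (abs_nonneg _)
  · intro h hh hne
    have hlt : h < j := by
      have := Finset.mem_range.1 hh
      omega
    simp [h0 h hlt]

theorem norm_leibnizSum_le (w : ℝ → ℝ) (σ : ℝ) (j : ℕ) {u : ℝ} (hu : 1 ≤ u) :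
    ‖leibnizSum w σ j u‖ ≤ ∑ h ∈ Finset.range (j + 1),
      (j.factorial : ℝ) * ((1 / (h.factorial : ℝ)) * (|iteratedDeriv h w u| / u)) := by
  refine (norm_sum_le _ _).trans (Finset.sum_le_sum fun h hh => ?_)
  have hle : h ≤ j := Nat.lt_succ_iff.1 (Finset.mem_range.1 hh)
  rw [norm_mul, norm_mul, Complex.norm_natCast, Complex.norm_real, Real.norm_eq_abs]
  have hfac : (j.choose h : ℝ) * (j - h).factorial = j.factorial * (1 / h.factorial) := by
    rw [← Nat.choose_mul_factorial_mul_factorial hle]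
    push_cast
    field_simp
  calc _ ≤ (j.choose h : ℝ) * (|iteratedDeriv h w u| * ((j - h).factorial / u)) := by
        gcongr
        exact norm_invDeriv_le σ _ hu
    _ = (j.choose h : ℝ) * (j - h).factorial * (|iteratedDeriv h w u| / u) := by ring
    _ = _ := by rw [hfac]; ring

theorem IsAdmissible.integral_leibnizSum_mul_cexp (hw : IsAdmissible k ξ w) (hξ : 1 < ξ)
    (σ b : ℝ) {j : ℕ} (hj : j < k) :
    b * Complex.I * ∫ u in (1:ℝ)..ξ, leibnizSum w σ j u * Complex.exp (b * (u * Complex.I)) =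
      leibnizSum w σ j ξ * Complex.exp (b * (ξ * Complex.I)) -
        leibnizSum w σ j 1 * Complex.exp (b * Complex.I) -
      ∫ u in (1:ℝ)..ξ, leibnizSum w σ (j + 1) u * Complex.exp (b * (u * Complex.I)) := by
  have hec : Continuous fun u : ℝ => Complex.exp (b * (u * Complex.I)) := by fun_prop
  have hde : ∀ u : ℝ, HasDerivAt (fun u : ℝ => Complex.exp (b * (u * Complex.I)))
      (Complex.exp (b * (u * Complex.I)) * (b * Complex.I)) u := fun u => by
    have : HasDerivAt (fun u : ℝ => (b : ℂ) * (u * Complex.I)) (b * Complex.I) u := by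
      simpa using ((hasDerivAt_id u).ofReal_comp.mul_const Complex.I).const_mul (b : ℂ)
    exact this.cexp
  have hi1 := (hw.intervalIntegrable_leibnizSum hξ.le σ (Nat.succ_le_of_lt hj)).mul_continuousOn
    (hec.continuousOn (s := Set.uIcc 1 ξ))
  have hi2 := (hw.intervalIntegrable_leibnizSum hξ.le σ hj.le).mul_continuousOn
    (hec.continuousOn (s := Set.uIcc 1 ξ))
  have h := intervalIntegral.integral_eq_sub_of_hasDerivAt_of_le hξ.le
    ((hw.continuousOn_leibnizSum σ hj).mul hec.continuousOn)
    (fun u hu => (hw.hasDerivAt_leibnizSum σ hj hu).mul (hde u)) ?_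
  · simp only [← mul_assoc (leibnizSum w σ j _)] at h
    rw [intervalIntegral.integral_add hi1 (hi2.mul_const _),
      intervalIntegral.integral_mul_const] at h
    simp only [Pi.mul_apply, Complex.ofReal_one, one_mul] at h
    linear_combination h
  · simp only [← mul_assoc (leibnizSum w σ j _)]
    exact hi1.add (hi2.mul_const _)

/-- `k`-fold integration by parts. -/
theorem IsAdmissible.norm_integral_mul_cexp_div_le (hw : IsAdmissible k ξ w) (hk : 1 ≤ k)
    (hξ : 1 < ξ) (σ : ℝ) {b : ℝ} (hb : b ≠ 0) :
    ‖∫ u in (1:ℝ)..ξ, (w u : ℂ) * (Complex.exp (b * ((σ : ℂ) + u * Complex.I)) /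
      ((σ : ℂ) + u * Complex.I))‖ ≤
      Real.exp (b * σ) * (2 * Real.pi * Nkxi k ξ w / |b| ^ k) := by
  set J : ℕ → ℂ := fun j =>
    ∫ u in (1:ℝ)..ξ, leibnizSum w σ j u * Complex.exp (b * (u * Complex.I)) with hJ
  have hbpos : 0 < |b| := abs_pos.2 hb
  have hnb : ‖(b : ℂ) * Complex.I‖ = |b| := by simp
  have hstep : ∀ j, j + 1 ≤ k - 1 → |b| * ‖J j‖ = ‖J (j + 1)‖ := by
    intro j hj
    have h0 := hw.leibnizSum_endpoint σ (j := j) (by omega)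
    have h := hw.integral_leibnizSum_mul_cexp hξ σ b (j := j) (by omega)
    rw [h0.1, h0.2, zero_mul, zero_mul, sub_zero, zero_sub] at h
    rw [← hnb, ← norm_mul, hJ]
    simp only
    rw [h, norm_neg]
  have hind : ∀ j, j ≤ k - 1 → |b| ^ j * ‖J 0‖ = ‖J j‖ := by
    intro j
    induction j with
    | zero => simp
    | succ j ih =>
      intro hj
      rw [← hstep j hj, ← ih (by omega)]
      ring
  have hkk : k - 1 + 1 = k := by omega
  have hexp : ∀ u : ℝ, ‖Complex.exp (b * (u * Complex.I))‖ = 1 := fun u => by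
    rw [← mul_assoc, ← Complex.ofReal_mul, Complex.norm_exp_ofReal_mul_I]
  have hend : ∀ u : ℝ, (u = 1 ∨ u = ξ) → ∀ h < k - 1, iteratedDeriv h w u = 0 := by
    rintro u (rfl | rfl) h hh
    · exact (hw.boundary h (by omega)).1
    · exact (hw.boundary h (by omega)).2
  have hlast : ‖J k‖ ≤ (k.factorial : ℝ) * ∑ h ∈ Finset.range (k + 1),
      (1 / (h.factorial : ℝ)) * ∫ u in (1:ℝ)..ξ, |iteratedDeriv h w u| / u := by
    have hint : ∀ h ∈ Finset.range (k + 1), IntervalIntegrable (fun u =>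
        (k.factorial : ℝ) * ((1 / (h.factorial : ℝ)) * (|iteratedDeriv h w u| / u)))
        volume 1 ξ := by
      intro h hh
      have hh' : h ≤ k := Nat.lt_succ_iff.1 (Finset.mem_range.1 hh)
      refine ((IntervalIntegrable.mul_continuousOn (hw.intervalIntegrable hξ.le hh').abs
        ?_).const_mul _).const_mul _
      refine ContinuousOn.inv₀ continuousOn_id fun u hu => ?_
      rw [Set.uIcc_of_le hξ.le] at hu
      exact (zero_lt_one.trans_le hu.1).ne'
    have h := intervalIntegral.norm_integral_le_of_norm_le hξ.le
      (f := fun u => leibnizSum w σ k u * Complex.exp (b * (u * Complex.I)))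
      (g := fun u => ∑ h ∈ Finset.range (k + 1),
        (k.factorial : ℝ) * ((1 / (h.factorial : ℝ)) * (|iteratedDeriv h w u| / u)))
      (μ := volume) (Filter.Eventually.of_forall fun u hu => by
        rw [norm_mul, hexp, mul_one]
        exact norm_leibnizSum_le w σ k hu.1.le) (by
        convert! IntervalIntegrable.sum _ hint using 1
        ext u
        simp)
    rw [intervalIntegral.integral_finsetSum hint] at h
    simpa only [intervalIntegral.integral_const_mul, ← Finset.mul_sum] using h
  have hJk : |b| * ‖J (k - 1)‖ ≤ 2 * Real.pi * Nkxi k ξ w := by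
    have h := hw.integral_leibnizSum_mul_cexp hξ σ b (j := k - 1) (by omega)
    rw [hkk] at h
    have hN : 2 * Real.pi * Nkxi k ξ w = |iteratedDeriv (k - 1) w ξ| / ξ +
        |iteratedDeriv (k - 1) w 1| + (k.factorial : ℝ) * ∑ h ∈ Finset.range (k + 1),
          (1 / (h.factorial : ℝ)) * ∫ u in (1:ℝ)..ξ, |iteratedDeriv h w u| / u := by
      have := Real.pi_pos
      rw [Nkxi]
      field_simp
    have e1 := norm_leibnizSum_le_of_forall_eq_zero w σ hξ.le (hend ξ (Or.inr rfl))
    have e2 := norm_leibnizSum_le_of_forall_eq_zero w σ le_rfl (hend 1 (Or.inl rfl))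
    rw [div_one] at e2
    have hexp1 := hexp 1
    rw [Complex.ofReal_one, one_mul] at hexp1
    rw [← hnb, ← norm_mul, hJ]
    simp only
    rw [h, hN]
    refine (norm_sub_le _ _).trans (add_le_add ((norm_sub_le _ _).trans (add_le_add ?_ ?_)) hlast)
    · rwa [norm_mul, hexp, mul_one]
    · rwa [norm_mul, hexp1, mul_one]
  have hJ0 : ‖J 0‖ ≤ 2 * Real.pi * Nkxi k ξ w / |b| ^ k := by
    rw [le_div_iff₀ (by positivity)]
    calc ‖J 0‖ * |b| ^ k = |b| * (|b| ^ (k - 1) * ‖J 0‖) := by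
          rw [← hkk]
          simp only [Nat.add_sub_cancel]
          ring
      _ ≤ _ := by rwa [hind _ le_rfl]
  have hfin : ∫ u in (1:ℝ)..ξ, (w u : ℂ) * (Complex.exp (b * ((σ : ℂ) + u * Complex.I)) /
      ((σ : ℂ) + u * Complex.I)) = (Real.exp (b * σ) : ℂ) * J 0 := by
    rw [hJ]
    simp only
    rw [← intervalIntegral.integral_const_mul]
    congr 1
    ext u
    simp only [leibnizSum, invDeriv, zero_add, Finset.range_one, Finset.sum_singleton,
      Nat.choose_self, iteratedDeriv_zero, Nat.sub_self, pow_zero, pow_one, Nat.factorial_zero]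
    rw [mul_add (b : ℂ), Complex.exp_add]
    push_cast
    ring
  rw [hfin, norm_mul, Complex.norm_real, Real.norm_eq_abs, Real.abs_exp]
  exact mul_le_mul_of_nonneg_left hJ0 (Real.exp_nonneg _)

end LeibnizSum

theorem perronReal_neg (b κ u : ℝ) : perronReal b (-κ) u = -perronReal (-b) κ u := by
  rw [perronReal, perronReal, ← intervalIntegral.integral_neg]
  congr 1
  ext τ
  simp only [neg_mul, Real.cos_neg, Real.sin_neg, even_two.neg_pow]
  ring

theorem abs_perronReal_le_div_abs (b : ℝ) {r u : ℝ} (hr : r ≠ 0) (hu : 0 ≤ u) :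
    |perronReal b r u| ≤ u / |r| := by
  rcases hr.lt_or_gt with h | h
  · obtain ⟨κ, rfl⟩ : ∃ κ, r = -κ := ⟨-r, by ring⟩
    rw [perronReal_neg, abs_neg, abs_neg, abs_of_pos (by linarith : 0 < κ)]
    exact abs_perronReal_le_div (-b) (by linarith) hu
  · rw [abs_of_pos h]
    exact abs_perronReal_le_div b h hu

theorem integral_exp_mul_left {b : ℝ} (hb : b ≠ 0) (r κ : ℝ) :
    ∫ σ in r..κ, Real.exp (b * σ) = (Real.exp (b * κ) - Real.exp (b * r)) / b := by
  rw [intervalIntegral.integral_comp_mul_left (fun x => Real.exp x) hb, integral_exp, smul_eq_mul]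
  ring

section LongRange

variable {k : ℕ} {ξ : ℝ} {w : ℝ → ℝ}

theorem IsAdmissible.continuousOn_uncurry_perron (hw : IsAdmissible k ξ w) (hk : 1 ≤ k)
    (b : ℝ) (s : Set ℝ) :
    ContinuousOn (Function.uncurry fun u σ : ℝ =>
      (w u : ℂ) * (Complex.exp (b * ((σ : ℂ) + u * Complex.I)) / ((σ : ℂ) + u * Complex.I)))
      (Set.Icc 1 ξ ×ˢ s) := by
  refine ContinuousOn.mul ?_ (ContinuousOn.div (by fun_prop) (by fun_prop) fun p hp => ?_)
  · exact Complex.continuous_ofReal.comp_continuousOn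
      ((hw.continuousOn hk).comp continuousOn_fst fun p hp => hp.1)
  · exact ofReal_add_mul_I_ne_zero (Or.inr (zero_lt_one.trans_le hp.1.1).ne')

theorem IsAdmissible.abs_integral_integral_im_le (hw : IsAdmissible k ξ w) (hk : 1 ≤ k)
    (hξ : 1 < ξ) {b r κ : ℝ} (hb : b ≠ 0) (hr : b * r ≤ b * κ) :
    |∫ u in (1:ℝ)..ξ, w u * ∫ σ in r..κ, (Complex.exp (b * ((σ : ℂ) + u * Complex.I)) /
      ((σ : ℂ) + u * Complex.I)).im| ≤
      Real.exp (b * κ) * (2 * Real.pi * Nkxi k ξ w / |b| ^ (k + 1)) := by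
  have hcont := hw.continuousOn_uncurry_perron hk b Set.univ
  have hswap : ∫ u in (1:ℝ)..ξ, w u * ∫ σ in r..κ,
      (Complex.exp (b * ((σ : ℂ) + u * Complex.I)) / ((σ : ℂ) + u * Complex.I)).im =
      ∫ σ in r..κ, (∫ u in (1:ℝ)..ξ, (w u : ℂ) *
        (Complex.exp (b * ((σ : ℂ) + u * Complex.I)) / ((σ : ℂ) + u * Complex.I))).im := by
    simp only [← intervalIntegral.integral_const_mul, ← Complex.im_ofReal_mul]
    rw [MeasureTheory.intervalIntegral_intervalIntegral_swap]
    · congr 1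
      ext σ
      have hi : IntervalIntegrable (fun u : ℝ => (w u : ℂ) *
          (Complex.exp (b * ((σ : ℂ) + u * Complex.I)) / ((σ : ℂ) + u * Complex.I)))
          volume 1 ξ :=
        ContinuousOn.intervalIntegrable_of_Icc hξ.le
          (hcont.comp (f := fun u : ℝ => (u, σ)) (by fun_prop) fun u hu => ⟨hu, trivial⟩)
      exact (Complex.imCLM.intervalIntegral_comp_comm hi)
    · have hK : IsCompact (Set.Icc 1 ξ ×ˢ Set.uIcc r κ) := isCompact_Icc.prod isCompact_uIcc
      refine IntegrableOn.mono_set (ContinuousOn.integrableOn_compact hK ?_)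
        (Set.prod_mono ?_ Set.uIoc_subset_uIcc)
      · exact Complex.continuous_im.comp_continuousOn
          (hcont.mono (Set.prod_mono le_rfl (Set.subset_univ _)))
      · rw [Set.uIoc_of_le hξ.le]
        exact Set.Ioc_subset_Icc_self
  have hbpos : 0 < |b| := abs_pos.2 hb
  have hN : 0 ≤ 2 * Real.pi * Nkxi k ξ w / |b| ^ k := by
    have h1 := integral_abs_div_le_Nkxi k hξ.le w
    have h2 : 0 ≤ (1 / Real.pi) * ∫ u in (1:ℝ)..ξ, |w u| / u :=
      mul_nonneg (by positivity) (integral_abs_div_nonneg hξ.le w)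
    have h3 : 0 ≤ Nkxi k ξ w := by linarith
    positivity
  rw [hswap, ← Real.norm_eq_abs]
  have hbound := intervalIntegral.norm_integral_le_abs_of_norm_le (a := r) (b := κ) (μ := volume)
    (f := fun σ : ℝ => (∫ u in (1:ℝ)..ξ, (w u : ℂ) *
        (Complex.exp (b * ((σ : ℂ) + u * Complex.I)) / ((σ : ℂ) + u * Complex.I))).im)
    (g := fun σ => Real.exp (b * σ) * (2 * Real.pi * Nkxi k ξ w / |b| ^ k))
    (Filter.Eventually.of_forall fun σ =>
      (Complex.abs_im_le_norm _).trans (hw.norm_integral_mul_cexp_div_le hk hξ σ hb))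
    (Continuous.intervalIntegrable (by fun_prop) _ _)
  refine hbound.trans ?_
  rw [intervalIntegral.integral_mul_const, integral_exp_mul_left hb, abs_mul, abs_of_nonneg hN,
    abs_div, abs_of_nonneg (sub_nonneg.2 (Real.exp_le_exp.2 hr))]
  calc _ ≤ Real.exp (b * κ) / |b| * (2 * Real.pi * Nkxi k ξ w / |b| ^ k) := by
        gcongr
        linarith [Real.exp_pos (b * r)]
    _ = _ := by
        rw [pow_succ]
        field_simp

theorem continuous_perronReal_of_ne_zero (b : ℝ) {r : ℝ} (hr : r ≠ 0) :
    Continuous (perronReal b r) := by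
  rcases hr.lt_or_gt with h | h
  · have : perronReal b r = fun u => -perronReal (-b) (-r) u := by
      ext u
      rw [← perronReal_neg, neg_neg]
    rw [this]
    exact (continuous_perronReal (-b) (neg_pos.2 h)).neg
  · exact continuous_perronReal b h

theorem IsAdmissible.abs_sub_integral_perronReal_le_add (hw : IsAdmissible k ξ w) (hk : 1 ≤ k)
    (hξ : 1 < ξ) {b r κ : ℝ} (hκ : 0 < κ) (hbr : b * r < 0) (hbκ : b * r ≤ b * κ) :
    |(if 0 ≤ b then 1 else 0) -
        (1 / Real.pi) * ∫ u in (1:ℝ)..ξ, Real.exp (b * κ) * perronReal b κ u * w u| ≤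
      1 / |r| * Lxi ξ w + Real.exp (b * κ) * (2 * Nkxi k ξ w / |b| ^ (k + 1)) := by
  have hb : b ≠ 0 := by rintro rfl; simp at hbr
  have hr : r ≠ 0 := by rintro rfl; simp at hbr
  have hshort := abs_integral_mul_le_Lxi hk hξ hw (p := perronReal b r) (α := 1 / |r|) (β := 0)
    fun u hu => (abs_perronReal_le_div_abs b hr (zero_le_one.trans hu)).trans
      (le_of_eq (by ring))
  have hlong := hw.abs_integral_integral_im_le hk hξ hb hbκ
  set c : ℝ := if 0 ≤ b then 1 else 0 with hc
  set J : ℝ → ℝ := fun u => ∫ σ in r..κ, (Complex.exp (b * ((σ : ℂ) + u * Complex.I)) /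
      ((σ : ℂ) + u * Complex.I)).im with hJ
  have hcut : ((if 0 < κ then Real.pi / 2 else -(Real.pi / 2)) -
      (if 0 < r then Real.pi / 2 else -(Real.pi / 2))) = Real.pi * c := by
    rcases hb.lt_or_gt with h | h
    · have hr0 : 0 < r := by nlinarith
      simp [hc, hκ, hr0, h.not_ge]
    · have hr0 : ¬ 0 < r := fun h0 => by nlinarith
      simp [hc, hκ, hr0, h.le]
  have hJu : ∀ u ∈ Set.uIcc 1 ξ, w u * J u = Real.exp (b * κ) * perronReal b κ u * w u -
      (Real.exp (b * r) * (perronReal b r u * w u) + Real.pi * c * w u) := by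
    intro u hu
    rw [Set.uIcc_of_le hξ.le] at hu
    have := perronReal_sub_perronReal b hr hκ.ne' (zero_lt_one.trans_le hu.1)
    rw [hcut] at this
    change _ = J u + _ at this
    linear_combination (-w u) * this
  have hwc := hw.continuousOn hk
  have hi : ∀ q : ℝ → ℝ, Continuous q → IntervalIntegrable (fun u => q u * w u) volume 1 ξ :=
    fun q hq => (hq.continuousOn.mul hwc).intervalIntegrable_of_Icc hξ.le
  have h1 := hi _ ((continuous_perronReal b hκ).const_mul (Real.exp (b * κ)))
  have h2 := hi _ (continuous_perronReal_of_ne_zero b hr)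
  have h3 := hi _ (continuous_const (y := Real.pi * c))
  rw [intervalIntegral.integral_congr hJu, intervalIntegral.integral_sub h1
    ((h2.const_mul _).add h3), intervalIntegral.integral_add (h2.const_mul _) h3,
    intervalIntegral.integral_const_mul, intervalIntegral.integral_const_mul, hw.normal] at hlong
  set A := ∫ u in (1:ℝ)..ξ, Real.exp (b * κ) * perronReal b κ u * w u
  set B := ∫ u in (1:ℝ)..ξ, perronReal b r u * w u
  have hsplit : c - 1 / Real.pi * A = -(Real.exp (b * r) * (1 / Real.pi * B)) -
      1 / Real.pi * (A - (Real.exp (b * r) * B + Real.pi * c * 1)) := by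
    field_simp
    ring
  have hexp : Real.exp (b * r) ≤ 1 := Real.exp_le_one_iff.2 hbr.le
  rw [zero_mul, add_zero] at hshort
  rw [hsplit]
  refine (abs_sub _ _).trans (add_le_add ?_ ?_)
  · rw [abs_neg, abs_mul, abs_of_pos (Real.exp_pos _)]
    exact (mul_le_of_le_one_left (abs_nonneg _) hexp).trans hshort
  · rw [abs_mul, abs_of_pos (by positivity : 0 < 1 / Real.pi)]
    refine (mul_le_mul_of_nonneg_left hlong (by positivity)).trans (le_of_eq ?_)
    field_simp

/-- The smoothed Perron error in the long range. -/
theorem IsAdmissible.abs_sub_integral_perronReal_le_div (hw : IsAdmissible k ξ w) (hk : 1 ≤ k)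
    (hξ : 1 < ξ) {b κ : ℝ} (hκ : 0 < κ) (hb : b ≠ 0) :
    |(if 0 ≤ b then 1 else 0) -
        (1 / Real.pi) * ∫ u in (1:ℝ)..ξ, Real.exp (b * κ) * perronReal b κ u * w u| ≤
      Real.exp (b * κ) * (2 * Nkxi k ξ w / |b| ^ (k + 1)) := by
  have hlim : Filter.Tendsto (fun R : ℝ => R⁻¹ * Lxi ξ w +
      Real.exp (b * κ) * (2 * Nkxi k ξ w / |b| ^ (k + 1))) Filter.atTop
      (nhds (0 * Lxi ξ w + Real.exp (b * κ) * (2 * Nkxi k ξ w / |b| ^ (k + 1)))) :=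
    (tendsto_inv_atTop_zero.mul_const _).add_const _
  rw [zero_mul, zero_add] at hlim
  refine ge_of_tendsto hlim ?_
  filter_upwards [Filter.eventually_gt_atTop κ] with R hR
  have hR0 : 0 < R := hκ.trans hR
  rcases hb.lt_or_gt with h | h
  · have := hw.abs_sub_integral_perronReal_le_add hk hξ (r := R) hκ
      (mul_neg_of_neg_of_pos h hR0) (mul_le_mul_of_nonpos_left hR.le h.le)
    rwa [abs_of_pos hR0, one_div R] at this
  · have := hw.abs_sub_integral_perronReal_le_add hk hξ (r := -R) hκ
      (mul_neg_of_pos_of_neg h (neg_neg_of_pos hR0))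
      (mul_le_mul_of_nonneg_left (by linarith) h.le)
    rwa [abs_neg, abs_of_pos hR0, one_div R] at this

end LongRange

theorem perronReal_mul (b κ u : ℝ) {T : ℝ} (hT : 0 < T) :
    perronReal b κ (T * u) = perronReal (T * b) (κ / T) u := by
  have h := intervalIntegral.mul_integral_comp_mul_left (a := 0) (b := u) (c := T)
    (f := fun τ : ℝ => (κ * Real.cos (b * τ) + τ * Real.sin (b * τ)) / (κ ^ 2 + τ ^ 2))
  rw [mul_zero] at h
  rw [perronReal, perronReal, ← h, ← intervalIntegral.integral_const_mul]
  congr 1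
  ext τ
  rw [show b * (T * τ) = T * b * τ by ring,
    show κ ^ 2 + (T * τ) ^ 2 = T ^ 2 * ((κ / T) ^ 2 + τ ^ 2) by field_simp,
    show κ * Real.cos (T * b * τ) + T * τ * Real.sin (T * b * τ) =
      T * (κ / T * Real.cos (T * b * τ) + τ * Real.sin (T * b * τ)) by field_simp,
    ← mul_div_assoc, ← mul_assoc, ← sq, mul_div_mul_left _ _ (by positivity)]

/-- The error of the smoothed Perron formula for a single term. -/
theorem IsAdmissible.abs_sub_integral_perronReal_mul_le {k : ℕ} {ξ : ℝ} {w : ℝ → ℝ}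
    (hw : IsAdmissible k ξ w) (hk : 1 ≤ k) (hξ : 1 < ξ) {β κ θ T : ℝ} (hκ : 0 < κ) (hθ : 0 < θ)
    (hθ' : 2 * Nkxi k ξ w / θ ^ (k + 1) = 1 + θ * Lxi ξ w) (hT : 0 < T) :
    |(if 0 ≤ β then 1 else 0) -
        (1 / Real.pi) * ∫ u in (1:ℝ)..ξ, Real.exp (β * κ) * perronReal β κ (T * u) * w u| ≤
      Real.exp (β * κ) * (2 * Nkxi k ξ w / T ^ (k + 1) / max (θ / T) |β| ^ (k + 1)) := by
  have hκT : 0 < κ / T := div_pos hκ hT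
  have hexp : T * β * (κ / T) = β * κ := by field_simp
  have hTβ : |T * β| = T * |β| := by rw [abs_mul, abs_of_pos hT]
  simp only [perronReal_mul _ _ _ hT]
  rcases le_or_gt |T * β| θ with hle | hlt
  · have hmax : max (θ / T) |β| = θ / T := max_eq_left (by
      rw [le_div_iff₀ hT, mul_comm, ← hTβ]; exact hle)
    have hs := abs_sub_integral_perronReal_le hk hξ hw
      (z := if 0 ≤ β then Real.exp (-(β * κ)) else 0)
      hκT hθ hθ' hle (by split_ifs <;> positivity)
      (by
        split_ifs with h
        · exact Real.exp_le_one_iff.2 (neg_nonpos.2 (by positivity))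
        · exact zero_le_one)
      (fun h => if_neg (not_le.2 (by nlinarith)))
    rw [← hθ'] at hs
    have heq : (if 0 ≤ β then (1:ℝ) else 0) -
        (1 / Real.pi) * ∫ u in (1:ℝ)..ξ, Real.exp (β * κ) * perronReal (T * β) (κ / T) u * w u =
        Real.exp (β * κ) * ((if 0 ≤ β then Real.exp (-(β * κ)) else 0) -
          (1 / Real.pi) * ∫ u in (1:ℝ)..ξ, perronReal (T * β) (κ / T) u * w u) := by
      simp only [mul_assoc (Real.exp (β * κ)), intervalIntegral.integral_const_mul]
      rw [mul_sub, mul_ite, ← Real.exp_add, add_neg_cancel, Real.exp_zero, mul_zero]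
      ring
    rw [heq, abs_mul, abs_of_pos (Real.exp_pos _), hmax]
    refine mul_le_mul_of_nonneg_left (hs.trans_eq ?_) (Real.exp_pos _).le
    rw [div_pow]
    field_simp
  · have hmax : max (θ / T) |β| = |β| := max_eq_right (by
      rw [div_le_iff₀ hT, mul_comm, ← hTβ]; exact hlt.le)
    have hb : T * β ≠ 0 := abs_pos.1 (hθ.trans hlt)
    have hl := hw.abs_sub_integral_perronReal_le_div hk hξ hκT hb
    rw [hexp, hTβ, mul_pow, ← div_div] at hl
    simp only [mul_nonneg_iff_of_pos_left hT] at hl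
    rw [hmax]
    exact hl

theorem norm_cexp_ofReal_mul (b κ τ : ℝ) :
    ‖Complex.exp (b * ((κ : ℂ) + τ * Complex.I))‖ = Real.exp (b * κ) := by
  rw [Complex.norm_exp]
  congr 1
  simp

section Exchange

variable {A : ℕ → ℂ} {β : ℕ → ℝ} {κ : ℝ}

theorem hasSum_integral_tsum_cexp_div (hκ : 0 < κ)
    (hS : Summable fun n => ‖A n‖ * Real.exp (β n * κ)) (t : ℝ) :
    HasSum (fun n => A n * ((2 * (Real.exp (β n * κ) * perronReal (β n) κ t) : ℝ) : ℂ))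
      (∫ τ in (-t)..t, (∑' n, A n * Complex.exp (β n * ((κ : ℂ) + τ * Complex.I))) /
        ((κ : ℂ) + τ * Complex.I)) := by
  have hne : ∀ τ : ℝ, (κ : ℂ) + τ * Complex.I ≠ 0 := fun τ =>
    ofReal_add_mul_I_ne_zero (Or.inl hκ.ne')
  have hnorm : ∀ τ : ℝ, κ ≤ ‖(κ : ℂ) + τ * Complex.I‖ := fun τ => by
    have := Complex.abs_re_le_norm ((κ : ℂ) + τ * Complex.I)
    simp only [Complex.add_re, Complex.ofReal_re, Complex.re_ofReal_mul, Complex.I_re, mul_zero,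
      add_zero] at this
    exact (le_abs_self κ).trans this
  have h := intervalIntegral.hasSum_integral_of_dominated_convergence (μ := volume)
    (a := -t) (b := t) (ι := ℕ)
    (F := fun n (τ : ℝ) => A n * (Complex.exp (β n * ((κ : ℂ) + τ * Complex.I)) /
        ((κ : ℂ) + τ * Complex.I)))
    (f := fun τ : ℝ => (∑' n, A n * Complex.exp (β n * ((κ : ℂ) + τ * Complex.I))) /
        ((κ : ℂ) + τ * Complex.I))
    (fun n _ => ‖A n‖ * Real.exp (β n * κ) / κ)
    (fun n => Continuous.aestronglyMeasurable (continuous_const.mul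
      (Continuous.div (by fun_prop) (by fun_prop) hne)))
    (fun n => Filter.Eventually.of_forall fun τ _ => ?_)
    (Filter.Eventually.of_forall fun τ _ => hS.div_const _)
    intervalIntegrable_const
    (Filter.Eventually.of_forall fun τ _ => ?_)
  · simpa only [intervalIntegral.integral_const_mul, integral_cexp_div_vertical _ hκ.ne'] using h
  · rw [norm_mul, norm_div, norm_cexp_ofReal_mul, mul_div_assoc]
    gcongr
    exact hnorm τ
  · have hsum : Summable fun n => A n * Complex.exp (β n * ((κ : ℂ) + τ * Complex.I)) :=
      Summable.of_norm (by simpa only [norm_mul, norm_cexp_ofReal_mul] using hS)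
    simpa only [mul_div_assoc] using hsum.hasSum.div_const ((κ : ℂ) + τ * Complex.I)

theorem IsAdmissible.hasSum_perron_average {k : ℕ} {ξ : ℝ} {w : ℝ → ℝ} (hw : IsAdmissible k ξ w)
    (hk : 1 ≤ k) (hξ : 1 < ξ) (hκ : 0 < κ)
    (hS : Summable fun n => ‖A n‖ * Real.exp (β n * κ)) {T : ℝ} (hT : 0 < T) {g : ℝ → ℂ}
    (hg : ∀ t, HasSum
      (fun n => A n * ((2 * (Real.exp (β n * κ) * perronReal (β n) κ t) : ℝ) : ℂ)) (g t)) :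
    HasSum (fun n => A n * (((1 / Real.pi) *
        ∫ u in (1:ℝ)..ξ, Real.exp (β n * κ) * perronReal (β n) κ (T * u) * w u : ℝ) : ℂ))
      ((1 / (2 * Real.pi * Complex.I)) *
        ∫ t in T..(ξ * T), (Complex.I * g t) * ((w (t / T) / T : ℝ) : ℂ)) := by
  have hcv : ∫ t in T..(ξ * T), (Complex.I * g t) * ((w (t / T) / T : ℝ) : ℂ) =
      ∫ u in (1:ℝ)..ξ, Complex.I * (g (T * u) * (w u : ℂ)) := by
    have := intervalIntegral.smul_integral_comp_mul_left (a := 1) (b := ξ)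
      (fun t => (Complex.I * g t) * ((w (t / T) / T : ℝ) : ℂ)) T
    rw [mul_one, mul_comm T ξ] at this
    rw [← this, ← intervalIntegral.integral_smul]
    congr 1
    ext u
    rw [mul_div_cancel_left₀ u hT.ne', Complex.real_smul, Complex.ofReal_div]
    have : (T : ℂ) ≠ 0 := Complex.ofReal_ne_zero.2 hT.ne'
    field_simp
  have hwc := hw.continuousOn hk
  have hIcc : Set.uIoc 1 ξ ⊆ Set.Icc 1 ξ := by
    rw [Set.uIoc_of_le hξ.le]
    exact Set.Ioc_subset_Icc_self
  have h := intervalIntegral.hasSum_integral_of_dominated_convergence (μ := volume)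
    (a := 1) (b := ξ) (ι := ℕ)
    (F := fun n (u : ℝ) => A n *
      ((2 * (Real.exp (β n * κ) * perronReal (β n) κ (T * u)) : ℝ) : ℂ) * (w u : ℂ))
    (f := fun u : ℝ => g (T * u) * (w u : ℂ))
    (fun n u => ‖A n‖ * Real.exp (β n * κ) * (2 * (T * ξ / κ) * |w u|))
    (fun n => ContinuousOn.aestronglyMeasurable (ContinuousOn.mono ?_ hIcc)
      measurableSet_uIoc)
    (fun n => Filter.Eventually.of_forall fun u hu => ?_)
    (Filter.Eventually.of_forall fun u _ => hS.mul_right _)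
    (by
      simp only [tsum_mul_right]
      exact ContinuousOn.intervalIntegrable_of_Icc hξ.le
        (continuousOn_const.mul (continuousOn_const.mul hwc.abs)))
    (Filter.Eventually.of_forall fun u _ => (hg (T * u)).mul_right _)
  · rw [hcv, intervalIntegral.integral_const_mul]
    have h' := h.mul_left (1 / (2 * (Real.pi : ℂ)))
    have hval : (1 / (2 * Real.pi * Complex.I)) *
        (Complex.I * ∫ u in (1:ℝ)..ξ, g (T * u) * (w u : ℂ)) =
        1 / (2 * Real.pi) * ∫ u in (1:ℝ)..ξ, g (T * u) * (w u : ℂ) := by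
      have := Complex.I_ne_zero
      field_simp
    rw [hval]
    refine h'.congr_fun fun n => ?_
    have hreal : ∀ u : ℝ, A n *
        ((2 * (Real.exp (β n * κ) * perronReal (β n) κ (T * u)) : ℝ) : ℂ) * (w u : ℂ) =
        2 * A n * ((Real.exp (β n * κ) * perronReal (β n) κ (T * u) * w u : ℝ) : ℂ) := by
      intro u
      push_cast
      ring
    simp only [hreal]
    rw [intervalIntegral.integral_const_mul, intervalIntegral.integral_ofReal, Complex.ofReal_mul,
      Complex.ofReal_div, Complex.ofReal_one]
    ring
  · have := continuous_perronReal (β n) hκ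
    refine ContinuousOn.mul (Continuous.continuousOn (by fun_prop)) ?_
    exact Complex.continuous_ofReal.comp_continuousOn hwc
  · have hu' := hIcc hu
    have hTu : 0 ≤ T * u := mul_nonneg hT.le (zero_le_one.trans hu'.1)
    have hp : |perronReal (β n) κ (T * u)| ≤ T * ξ / κ :=
      (abs_perronReal_le_div _ hκ hTu).trans (by gcongr; exact hu'.2)
    rw [norm_mul, norm_mul, Complex.norm_real, Complex.norm_real, Real.norm_eq_abs,
      Real.norm_eq_abs, abs_mul, abs_mul, abs_of_pos (Real.exp_pos _), abs_two]
    calc _ = ‖A n‖ * Real.exp (β n * κ) * (2 * |perronReal (β n) κ (T * u)| * |w u|) := by ring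
      _ ≤ _ := by gcongr

end Exchange

theorem integral_Ioi_div_pow {m : ℝ} (hm : 0 < m) (k : ℕ) (c : ℝ) :
    IntegrableOn (fun u : ℝ => c / u ^ (k + 2)) (Set.Ioi m) ∧
      ∫ u in Set.Ioi m, c / u ^ (k + 2) = c / ((k + 1) * m ^ (k + 1)) := by
  have hk : -((k : ℝ) + 2) < -1 := by linarith [(Nat.cast_nonneg k : (0:ℝ) ≤ k)]
  have heq : ∀ u ∈ Set.Ioi m, c / u ^ (k + 2) = c * u ^ (-((k : ℝ) + 2)) := by
    intro u hu
    rw [Real.rpow_neg (hm.trans hu).le, div_eq_mul_inv, ← Real.rpow_natCast]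
    norm_num
  constructor
  · exact IntegrableOn.congr_fun (Integrable.const_mul (integrableOn_Ioi_rpow_of_lt hk hm) c)
      (fun u hu => (heq u hu).symm) measurableSet_Ioi
  · rw [setIntegral_congr_fun measurableSet_Ioi heq, integral_const_mul,
      integral_Ioi_rpow_of_lt hk hm,
      show -((k : ℝ) + 2) + 1 = -((k + 1 : ℕ) : ℝ) by push_cast; ring,
      Real.rpow_neg hm.le, Real.rpow_natCast]
    push_cast
    field_simp

theorem hasSum_integral_tsum_div_pow {c β : ℕ → ℝ} (hc : ∀ n, 0 ≤ c n) (hS : Summable c)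
    {θ : ℝ} (hθ : 0 < θ) (k : ℕ) :
    HasSum (fun n => c n / ((k + 1) * max θ |β n| ^ (k + 1)))
      (∫ u in Set.Ioi θ, (∑' n, if |β n| ≤ u then c n else 0) / u ^ (k + 2)) := by
  have hm : ∀ n, 0 < max θ |β n| := fun n => hθ.trans_le (le_max_left _ _)
  have hae : ∀ n, (fun u : ℝ => (if |β n| ≤ u then c n else 0) / u ^ (k + 2))
      =ᵐ[volume.restrict (Set.Ioi θ)]
      (Set.Ioi (max θ |β n|)).indicator fun u => c n / u ^ (k + 2) := by
    intro n
    have hne : ∀ᵐ u : ℝ ∂volume.restrict (Set.Ioi θ), u ≠ |β n| :=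
      ae_restrict_of_ae (Measure.ae_ne volume _)
    filter_upwards [hne, ae_restrict_mem measurableSet_Ioi] with u hu hu'
    rw [Set.mem_Ioi] at hu'
    by_cases h : |β n| ≤ u
    · rw [if_pos h, Set.indicator_of_mem]
      exact max_lt hu' (lt_of_le_of_ne h hu.symm)
    · rw [if_neg h, zero_div, Set.indicator_of_notMem]
      exact fun h' => h ((le_max_right _ _).trans (le_of_lt h'))
  have hsub : ∀ n, Set.Ioi (max θ |β n|) ∩ Set.Ioi θ = Set.Ioi (max θ |β n|) := fun n =>
    Set.inter_eq_left.2 (Set.Ioi_subset_Ioi (le_max_left _ _))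
  have hint : ∀ n, ∫ u in Set.Ioi θ, (if |β n| ≤ u then c n else 0) / u ^ (k + 2) =
      c n / ((k + 1) * max θ |β n| ^ (k + 1)) := by
    intro n
    rw [integral_congr_ae (hae n), integral_indicator measurableSet_Ioi,
      Measure.restrict_restrict measurableSet_Ioi, hsub, (integral_Ioi_div_pow (hm n) k _).2]
  have hnn : ∀ n, ∀ u ∈ Set.Ioi θ,
      ‖(if |β n| ≤ u then c n else 0) / u ^ (k + 2)‖ =
        (if |β n| ≤ u then c n else 0) / u ^ (k + 2) := by
    intro n u hu
    have hu0 : 0 < u := hθ.trans hu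
    refine Real.norm_of_nonneg (div_nonneg ?_ (by positivity))
    split_ifs
    exacts [hc n, le_rfl]
  have h := hasSum_integral_of_summable_integral_norm (μ := volume.restrict (Set.Ioi θ))
    (F := fun n (u : ℝ) => (if |β n| ≤ u then c n else 0) / u ^ (k + 2)) ?_ ?_
  · simpa only [hint, tsum_div_const] using h
  · intro n
    refine Integrable.congr ?_ (hae n).symm
    rw [integrable_indicator_iff measurableSet_Ioi, IntegrableOn,
      Measure.restrict_restrict measurableSet_Ioi, hsub]
    exact (integral_Ioi_div_pow (hm n) k _).1
  · have hint' : ∀ n, ∫ u in Set.Ioi θ, ‖(if |β n| ≤ u then c n else 0) / u ^ (k + 2)‖ =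
        c n / ((k + 1) * max θ |β n| ^ (k + 1)) := fun n =>
      (setIntegral_congr_fun measurableSet_Ioi (hnn n)).trans (hint n)
    simp only [hint']
    refine Summable.of_nonneg_of_le (fun n => div_nonneg (hc n) (by have := hm n; positivity))
      (fun n => ?_) (hS.div_const ((k + 1) * θ ^ (k + 1)))
    have := hc n
    gcongr
    exact le_max_left _ _

theorem div_natCast_cpow_mul_cpow {x : ℝ} (hx : 0 < x) {s : ℂ} (hs : s ≠ 0) (a : ℂ) (n : ℕ) :
    a / (n : ℂ) ^ s * (x : ℂ) ^ s =
      (if n = 0 then 0 else a) * Complex.exp ((Real.log (x / n) : ℝ) * s) := by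
  rcases Nat.eq_zero_or_pos n with rfl | hn
  · simp [hs]
  have hn0 : (n : ℝ) ≠ 0 := by exact_mod_cast hn.ne'
  rw [if_neg hn.ne', Real.log_div hx.ne' hn0, Complex.ofReal_sub, sub_mul, Complex.exp_sub,
    Complex.cpow_def_of_ne_zero (by exact_mod_cast hn.ne'),
    Complex.cpow_def_of_ne_zero (by exact_mod_cast hx.ne'), Complex.natCast_log,
    Complex.ofReal_log hx.le]
  ring

theorem stmt6 (k : ℕ) (hk : 1 ≤ k) (ξ : ℝ) (hξ : 1 < ξ) (w : ℝ → ℝ)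
    (hw : IsAdmissible k ξ w) (a : ℕ → ℂ) (κa : ℝ) (hκa : 0 < κa)
    (hconv : ∀ s : ℂ, κa < s.re → Summable fun n : ℕ => ‖a n / (n : ℂ) ^ s‖)
    (F : ℂ → ℂ) (hF : ∀ s : ℂ, κa < s.re → F s = ∑' n : ℕ, a n / (n : ℂ) ^ s)
    (x T κ : ℝ) (hx : 1 ≤ x) (hT : 1 ≤ T) (hκ : κa < κ)
    (θ' : ℝ) (hθpos : 0 < θ')
    (hθ : 2 * Nkxi k ξ w / θ' ^ (k + 1) = 1 + θ' * Lxi ξ w) :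
    ‖(∑ n ∈ Finset.Icc 1 ⌊x⌋₊, a n) -
        (1 / (2 * Real.pi * Complex.I)) *
          ∫ t in T..(ξ * T),
            (Complex.I * ∫ τ in (-t)..t,
              F ((κ : ℂ) + τ * Complex.I) * (x : ℂ) ^ ((κ : ℂ) + τ * Complex.I) /
                ((κ : ℂ) + τ * Complex.I)) *
            ((w (t / T) / T : ℝ) : ℂ)‖ ≤
      (k + 1) * (2 * Nkxi k ξ w / T ^ (k + 1)) *
        ∫ u in Set.Ioi (θ' / T),
          (∑' n : ℕ, if 1 ≤ n ∧ |Real.log (x / n)| ≤ u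
            then ‖a n‖ / (n : ℝ) ^ κ else 0) * x ^ κ / u ^ (k + 2) := by
  have hx0 : 0 < x := by linarith
  have hT0 : 0 < T := by linarith
  have hκ0 : 0 < κ := hκa.trans hκ
  set A : ℕ → ℂ := fun n => if n = 0 then 0 else a n with hA
  set β : ℕ → ℝ := fun n => Real.log (x / n) with hβ
  have hterm : ∀ n (τ : ℝ), a n / (n : ℂ) ^ ((κ : ℂ) + τ * Complex.I) *
      (x : ℂ) ^ ((κ : ℂ) + τ * Complex.I) =
      A n * Complex.exp (β n * ((κ : ℂ) + τ * Complex.I)) := fun n τ =>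
    div_natCast_cpow_mul_cpow hx0 (ofReal_add_mul_I_ne_zero (Or.inl hκ0.ne')) (a n) n
  have hre : ∀ τ : ℝ, κa < ((κ : ℂ) + τ * Complex.I).re := fun τ => by simpa using hκ
  have hS : Summable fun n => ‖A n‖ * Real.exp (β n * κ) := by
    refine ((hconv _ (hre 0)).mul_right ‖(x : ℂ) ^ ((κ : ℂ) + (0 : ℝ) * Complex.I)‖).congr
      fun n => ?_
    rw [← norm_mul, hterm, norm_mul, norm_cexp_ofReal_mul]
  have hF' : ∀ τ : ℝ, F ((κ : ℂ) + τ * Complex.I) * (x : ℂ) ^ ((κ : ℂ) + τ * Complex.I) =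
      ∑' n, A n * Complex.exp (β n * ((κ : ℂ) + τ * Complex.I)) := by
    intro τ
    rw [hF _ (hre τ), ← tsum_mul_right]
    exact tsum_congr fun n => hterm n τ
  have hfin : HasSum (fun n => A n * ((if 0 ≤ β n then 1 else 0 : ℝ) : ℂ))
      (∑ n ∈ Finset.Icc 1 ⌊x⌋₊, a n) := by
    have hzero : ∀ n ∉ Finset.Icc 1 ⌊x⌋₊, A n * ((if 0 ≤ β n then 1 else 0 : ℝ) : ℂ) = 0 := by
      intro n hn
      rcases Nat.eq_zero_or_pos n with rfl | hn0
      · simp [hA]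
      · have hlt : x < n := by
          rw [Finset.mem_Icc, not_and, not_le] at hn
          exact (Nat.floor_lt hx0.le).1 (hn hn0)
        have hneg : β n < 0 := Real.log_neg (by positivity)
          ((div_lt_one (by positivity)).2 hlt)
        rw [if_neg (not_le.2 hneg), Complex.ofReal_zero, mul_zero]
    have hsum := hasSum_sum_of_ne_finset_zero (L := SummationFilter.unconditional ℕ) hzero
    rwa [Finset.sum_congr rfl fun n hn => ?_] at hsum
    obtain ⟨hn1, hn2⟩ := Finset.mem_Icc.1 hn
    have hn0 : (0 : ℝ) < n := by exact_mod_cast hn1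
    have hpos : 0 ≤ β n := Real.log_nonneg
      ((one_le_div hn0).2 ((Nat.le_floor_iff hx0.le).1 hn2))
    rw [if_pos hpos, hA]
    simp [(Nat.one_le_iff_ne_zero.1 hn1)]
  have havg := hw.hasSum_perron_average hk hξ hκ0 hS hT0
    (hasSum_integral_tsum_cexp_div hκ0 hS)
  have hmaj := (hasSum_integral_tsum_div_pow (β := β)
    (fun n => mul_nonneg (norm_nonneg (A n)) (Real.exp_pos (β n * κ)).le) hS
    (div_pos hθpos hT0) k).mul_left ((k + 1) * (2 * Nkxi k ξ w / T ^ (k + 1)))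
  have hrhs : ∀ u : ℝ, (∑' n : ℕ, if 1 ≤ n ∧ |Real.log (x / n)| ≤ u
      then ‖a n‖ / (n : ℝ) ^ κ else 0) * x ^ κ =
      ∑' n, if |β n| ≤ u then ‖A n‖ * Real.exp (β n * κ) else 0 := by
    intro u
    rw [← tsum_mul_right]
    refine tsum_congr fun n => ?_
    rcases Nat.eq_zero_or_pos n with rfl | hn0
    · simp [hA]
    · have hn : (0 : ℝ) < n := by exact_mod_cast hn0
      have hexp : Real.exp (β n * κ) = x ^ κ / (n : ℝ) ^ κ := by
        rw [← Real.div_rpow hx0.le hn.le, Real.rpow_def_of_pos (div_pos hx0 hn)]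
      rw [hexp]
      simp only [hA, hβ, hn0.ne', if_false, ite_mul, zero_mul,
        show 1 ≤ n from hn0, true_and]
      congr 1
      ring
  simp only [hF', hrhs]
  have hdiff := hfin.sub havg
  rw [← hdiff.tsum_eq]
  refine tsum_of_norm_bounded hmaj fun n => ?_
  rw [← mul_sub, ← Complex.ofReal_sub, norm_mul, Complex.norm_real, Real.norm_eq_abs]
  refine (mul_le_mul_of_nonneg_left (hw.abs_sub_integral_perronReal_mul_le hk hξ (β := β n)
    hκ0 hθpos hθ hT0) (norm_nonneg (A n))).trans_eq ?_
  field_simp
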